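/- arXiv:1301.0663 — 5 statements merged into one kernel-verified Lean document; each statement's English description precedes it below -/
import Mathlib

section
/- Let γ = (ξ,η) ∈ 𝒢, let D, T ∈ ℕ* with 3 ≤ D ≤ T ≤ C(⌊D/3⌋+1, 2), and let α ∈ ℂ³ with ‖α‖ = 1. Then dist(α,(1:γ))^T ≤ c₅^T·T^{6T·log(T)}·|I^{(γ,T)}_D|_α, where c₅ = (2c₂(γ)+3)·c₃(γ)², c₂(γ) = max{1,|ξ|,|η|} and c₃(γ) = (2+|ξ|+|η|⁻¹)·c₂(γ). -/
open MvPolynomial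

/-- The derivation `𝒟 = X₀·∂/∂X₁ + X₂·∂/∂X₂` of `ℂ[X₀,X₁,X₂]`. -/
noncomputable def DD : MvPolynomial (Fin 3) ℂ → MvPolynomial (Fin 3) ℂ :=
  fun P => X 0 * pderiv 1 P + X 2 * pderiv 2 P

/-- The norm of a polynomial: the max of the absolute values of its coefficients. -/
noncomputable def pnorm (P : MvPolynomial (Fin 3) ℂ) : ℝ :=
  ((P.support.sup fun v => ‖P.coeff v‖₊ : NNReal) : ℝ)

/-- The length of a polynomial: the sum of the absolute values of its coefficients. -/
noncomputable def plen (P : MvPolynomial (Fin 3) ℂ) : ℝ :=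
  ∑ v ∈ P.support, ‖P.coeff v‖

/-- The automorphism `τ_γ` of `ℂ[X₀,X₁,X₂]`, `τ_γ(P)(X₀,X₁,X₂) = P(X₀, ξX₀+X₁, ηX₂)`. -/
noncomputable def tauG (ξ η : ℂ) : MvPolynomial (Fin 3) ℂ →ₐ[ℂ] MvPolynomial (Fin 3) ℂ :=
  aeval ![X 0, C ξ * X 0 + X 1, C η * X 2]

/-- The ideal `I^{(γ,T)}` generated by the homogeneous polynomials all of whose
derivatives `𝒟^i P`, `0 ≤ i < T`, vanish at `(1,ξ,η)`. -/
noncomputable def Igam (ξ η : ℂ) (T : ℕ) : Ideal (MvPolynomial (Fin 3) ℂ) :=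
  Ideal.span {P | (∃ d, P.IsHomogeneous d) ∧ ∀ i < T, eval ![1, ξ, η] (DD^[i] P) = 0}

noncomputable def c2c (ξ η : ℂ) : ℝ := max 1 (max ‖ξ‖ ‖η‖)

noncomputable def c3c (ξ η : ℂ) : ℝ := (2 + ‖ξ‖ + ‖η‖⁻¹) * c2c ξ η

noncomputable def c4c (ξ η : ℂ) : ℝ := 3 * c2c ξ η * Real.exp (2 * (c2c ξ η) ^ 2)

noncomputable def c5c (ξ η : ℂ) : ℝ := (2 * c2c ξ η + 3) * (c3c ξ η) ^ 2

/-- Projective distance from `α` (of norm 1) to the point `(1:ξ:η)`. -/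
noncomputable def pdist (ξ η α₀ α₁ α₂ : ℂ) : ℝ :=
  (c2c ξ η)⁻¹ * max ‖α₁ - α₀ * ξ‖ (max ‖α₂ - α₀ * η‖ ‖α₁ * η - α₂ * ξ‖)

/-- Distance from `α` to the analytic curve `A_γ = {(1:ξ+z:ηe^z)}`. -/
noncomputable def adist (ξ η α₀ α₁ α₂ : ℂ) : ℝ :=
  ‖α₂ / α₀ - η * Complex.exp (α₁ / α₀ - ξ)‖

/-- `|I^{(γ,T)}_D|_α = sup{|P(α)| : P ∈ I^{(γ,T)}_D, ‖P‖ ≤ 1}`. -/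
noncomputable def Isup (ξ η : ℂ) (T D : ℕ) (α : Fin 3 → ℂ) : ℝ :=
  sSup {x : ℝ | ∃ P : MvPolynomial (Fin 3) ℂ,
    P ∈ Igam ξ η T ∧ P.IsHomogeneous D ∧ pnorm P ≤ 1 ∧ x = ‖eval α P‖}

/-! ### The length of a polynomial -/

lemma plen_nonneg (P : MvPolynomial (Fin 3) ℂ) : 0 ≤ plen P :=
  Finset.sum_nonneg fun _ _ => norm_nonneg _

lemma plen_eq_sum {P : MvPolynomial (Fin 3) ℂ} {s : Finset (Fin 3 →₀ ℕ)} (h : P.support ⊆ s) :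
    plen P = ∑ v ∈ s, ‖P.coeff v‖ :=
  Finset.sum_subset h fun v _ hv => by simp [notMem_support_iff.mp hv]

lemma plen_add_le (P Q : MvPolynomial (Fin 3) ℂ) : plen (P + Q) ≤ plen P + plen Q := by
  classical
  rw [plen_eq_sum (support_add (p := P) (q := Q)),
    plen_eq_sum (P := P) Finset.subset_union_left,
    plen_eq_sum (P := Q) Finset.subset_union_right, ← Finset.sum_add_distrib]
  exact Finset.sum_le_sum fun v _ => by simpa using norm_add_le _ _

@[simp] lemma plen_zero : plen 0 = 0 := by simp [plen]

@[simp] lemma plen_smul (c : ℂ) (P : MvPolynomial (Fin 3) ℂ) : plen (c • P) = ‖c‖ * plen P := by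
  rw [plen_eq_sum (support_smul (a := c) (f := P)), plen, Finset.mul_sum]
  exact Finset.sum_congr rfl fun v _ => by simp

@[simp] lemma plen_neg (P : MvPolynomial (Fin 3) ℂ) : plen (-P) = plen P := by
  simpa using plen_smul (-1) P

lemma plen_sub_le (P Q : MvPolynomial (Fin 3) ℂ) : plen (P - Q) ≤ plen P + plen Q := by
  simpa [sub_eq_add_neg] using plen_add_le P (-Q)

lemma plen_sum_le {ι : Type*} (s : Finset ι) (f : ι → MvPolynomial (Fin 3) ℂ) :
    plen (∑ i ∈ s, f i) ≤ ∑ i ∈ s, plen (f i) := by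
  classical
  induction s using Finset.induction_on with
  | empty => simp
  | insert a s ha ih =>
    rw [Finset.sum_insert ha, Finset.sum_insert ha]
    exact (plen_add_le _ _).trans (by gcongr)

@[simp] lemma plen_monomial (v : Fin 3 →₀ ℕ) (c : ℂ) : plen (monomial v c) = ‖c‖ := by
  classical
  rw [plen_eq_sum (s := {v}) support_monomial_subset]
  simp

@[simp] lemma plen_X (i : Fin 3) : plen (X i) = 1 := by
  simp [X]

@[simp] lemma plen_C (c : ℂ) : plen (C c) = ‖c‖ := plen_monomial 0 c

lemma plen_linearMap_le (f : MvPolynomial (Fin 3) ℂ →ₗ[ℂ] MvPolynomial (Fin 3) ℂ)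
    (P : MvPolynomial (Fin 3) ℂ) (c : ℝ)
    (h : ∀ v ∈ P.support, plen (f (monomial v 1)) ≤ c) : plen (f P) ≤ c * plen P := by
  have hP : f P = ∑ v ∈ P.support, P.coeff v • f (monomial v 1) := by
    conv_lhs => rw [P.as_sum, map_sum]
    refine Finset.sum_congr rfl fun v _ => ?_
    rw [← map_smul, smul_monomial, smul_eq_mul, mul_one]
  rw [hP, plen.eq_def P, Finset.mul_sum]
  refine (plen_sum_le _ _).trans (Finset.sum_le_sum fun v hv => ?_)
  rw [plen_smul, mul_comm c]
  exact mul_le_mul_of_nonneg_left (h v hv) (norm_nonneg _)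

lemma plen_mul_le (P Q : MvPolynomial (Fin 3) ℂ) : plen (P * Q) ≤ plen P * plen Q := by
  refine plen_linearMap_le (LinearMap.mulLeft ℂ P) Q _ fun v _ => ?_
  have := plen_linearMap_le (LinearMap.mulRight ℂ (monomial v 1)) P 1 fun u _ => by
    simp [monomial_mul]
  simpa using this

lemma plen_pow_le (P : MvPolynomial (Fin 3) ℂ) (n : ℕ) : plen (P ^ n) ≤ plen P ^ n := by
  induction n with
  | zero => simpa using (plen_C 1).le
  | succ n ih =>
    rw [pow_succ, pow_succ]
    exact (plen_mul_le _ _).trans (mul_le_mul_of_nonneg_right ih (plen_nonneg _))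

lemma plen_X_pow_mul_le (i : Fin 3) (n : ℕ) (P : MvPolynomial (Fin 3) ℂ) :
    plen (X i ^ n * P) ≤ plen P := by
  have h := (plen_mul_le (X i ^ n) P).trans
    (mul_le_mul_of_nonneg_right (plen_pow_le (X i) n) (plen_nonneg _))
  simpa using h

lemma pnorm_le_plen (P : MvPolynomial (Fin 3) ℂ) : pnorm P ≤ plen P := by
  have h : (P.support.sup fun v => ‖P.coeff v‖₊) ≤ ∑ v ∈ P.support, ‖P.coeff v‖₊ :=
    Finset.sup_le fun v hv =>
      Finset.single_le_sum (f := fun v => ‖P.coeff v‖₊) (fun _ _ => zero_le) hv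
  have h' : pnorm P ≤ ((∑ v ∈ P.support, ‖P.coeff v‖₊ : NNReal) : ℝ) := by exact_mod_cast h
  simpa [plen] using h'

lemma norm_coeff_le_pnorm (P : MvPolynomial (Fin 3) ℂ) (v : Fin 3 →₀ ℕ) :
    ‖P.coeff v‖ ≤ pnorm P := by
  by_cases hv : v ∈ P.support
  · have h := Finset.le_sup (f := fun v => ‖P.coeff v‖₊) hv
    exact_mod_cast h
  · rw [notMem_support_iff.mp hv, norm_zero]
    exact NNReal.coe_nonneg _

lemma MvPolynomial.IsHomogeneous.sum_eq_of_mem_support {P : MvPolynomial (Fin 3) ℂ} {D : ℕ}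
    (hP : P.IsHomogeneous D) {v : Fin 3 →₀ ℕ} (hv : v ∈ P.support) : ∑ i, v i = D := by
  rw [← Finsupp.degree_eq_sum, Finsupp.degree_eq_weight_one]
  exact hP (mem_support_iff.mp hv)

lemma plen_le_card_mul_pnorm {P : MvPolynomial (Fin 3) ℂ} {D : ℕ} (hP : P.IsHomogeneous D) :
    plen P ≤ ((Finset.univ : Finset (Fin 3)).finsuppAntidiag D).card * pnorm P := by
  have hs : P.support ⊆ (Finset.univ : Finset (Fin 3)).finsuppAntidiag D := fun v hv => by
    simp [Finset.mem_finsuppAntidiag, hP.sum_eq_of_mem_support hv]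
  rw [plen_eq_sum hs, ← nsmul_eq_mul]
  exact Finset.sum_le_card_nsmul _ _ _ fun v _ => norm_coeff_le_pnorm P v

lemma norm_eval_le_plen {p : Fin 3 → ℂ} (hp : ∀ i, ‖p i‖ ≤ 1) (P : MvPolynomial (Fin 3) ℂ) :
    ‖eval p P‖ ≤ plen P := by
  rw [eval_eq, plen]
  refine (norm_sum_le _ _).trans (Finset.sum_le_sum fun v _ => ?_)
  rw [norm_mul, norm_prod]
  refine mul_le_of_le_one_right (norm_nonneg _) (Finset.prod_le_one (fun _ _ => norm_nonneg _) ?_)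
  intro i _
  rw [norm_pow]
  exact pow_le_one₀ (norm_nonneg _) (hp i)

/-! ### The derivation -/

/-- `DD` as a bundled derivation. -/
noncomputable def derivD : Derivation ℂ (MvPolynomial (Fin 3) ℂ) (MvPolynomial (Fin 3) ℂ) :=
  (X 0 : MvPolynomial (Fin 3) ℂ) • pderiv 1 + (X 2 : MvPolynomial (Fin 3) ℂ) • pderiv 2

lemma DD_eq_derivD : DD = derivD := by
  ext1 P
  simp [DD, derivD]

@[simp] lemma derivD_X_zero : derivD (X 0) = 0 := by
  simp [derivD, pderiv_X]

@[simp] lemma derivD_X_one : derivD (X 1) = X 0 := by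
  simp [derivD, pderiv_X]

@[simp] lemma derivD_X_two : derivD (X 2) = X 2 := by
  simp [derivD, pderiv_X]

lemma derivD_X_zero_pow_mul (m : ℕ) (P : MvPolynomial (Fin 3) ℂ) :
    derivD (X 0 ^ m * P) = X 0 ^ m * derivD P := by
  simp [Derivation.leibniz, Derivation.leibniz_pow]

lemma isHomogeneous_derivD {P : MvPolynomial (Fin 3) ℂ} {D : ℕ} (hD : D ≠ 0)
    (hP : P.IsHomogeneous D) : (derivD P).IsHomogeneous D := by
  have h (i j : Fin 3) : (X i * pderiv j P).IsHomogeneous D := by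
    have := (isHomogeneous_X ℂ i).mul (hP.pderiv (i := j))
    rwa [Nat.add_sub_cancel' (Nat.one_le_iff_ne_zero.mpr hD)] at this
  exact (h 0 1).add (h 2 2)

lemma plen_derivD_le {P : MvPolynomial (Fin 3) ℂ} {D : ℕ} (hP : P.IsHomogeneous D) :
    plen (derivD P) ≤ D * plen P := by
  refine plen_linearMap_le derivD.toLinearMap P D fun v hv => ?_
  have h := hP.sum_eq_of_mem_support hv
  rw [Fin.sum_univ_three] at h
  have hX (i j : Fin 3) : plen (X i * pderiv j (monomial v (1 : ℂ))) ≤ v j := by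
    have := plen_mul_le (X i) (pderiv j (monomial v (1 : ℂ)))
    simpa [pderiv_monomial] using this
  have hc : ((v 0 + v 1 + v 2 : ℕ) : ℝ) = D := by rw [h]
  push_cast at hc
  have h0 : (0 : ℝ) ≤ v 0 := Nat.cast_nonneg _
  calc plen (derivD (monomial v 1))
      ≤ v 1 + v 2 := (plen_add_le _ _).trans (add_le_add (hX 0 1) (hX 2 2))
    _ ≤ D := by linarith

/-! ### Vanishing along the curve -/

/-- The first `T` derivatives of `P` vanish at `p`. -/
def VanishesTo (p : Fin 3 → ℂ) (T : ℕ) (P : MvPolynomial (Fin 3) ℂ) : Prop :=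
  ∀ i < T, eval p (derivD^[i] P) = 0

section VanishesTo

variable {p : Fin 3 → ℂ} {T : ℕ} {P Q : MvPolynomial (Fin 3) ℂ}

lemma vanishesTo_zero : VanishesTo p 0 P := fun _ h => absurd h (Nat.not_lt_zero _)

lemma vanishesTo_succ :
    VanishesTo p (T + 1) P ↔ eval p P = 0 ∧ VanishesTo p T (derivD P) := by
  refine ⟨fun h => ⟨h 0 T.succ_pos, fun i hi => h (i + 1) (by lia)⟩, fun h i hi => ?_⟩
  cases i with
  | zero => exact h.1
  | succ i => exact h.2 i (by lia)

lemma VanishesTo.mono {S : ℕ} (h : VanishesTo p T P) (hS : S ≤ T) : VanishesTo p S P :=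
  fun i hi => h i (hi.trans_le hS)

lemma VanishesTo.add (hP : VanishesTo p T P) (hQ : VanishesTo p T Q) :
    VanishesTo p T (P + Q) := fun i hi => by
  simp [iterate_map_add, hP i hi, hQ i hi]

lemma VanishesTo.smul (c : ℂ) (hP : VanishesTo p T P) : VanishesTo p T (c • P) := by
  induction T generalizing P with
  | zero => exact vanishesTo_zero
  | succ T ih =>
    rw [vanishesTo_succ] at hP ⊢
    exact ⟨by simp [hP.1], by simpa using ih hP.2⟩

lemma VanishesTo.sub (hP : VanishesTo p T P) (hQ : VanishesTo p T Q) :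
    VanishesTo p T (P - Q) := by
  simpa [sub_eq_add_neg] using hP.add (hQ.smul (-1))

lemma VanishesTo.mul {T₁ T₂ : ℕ} (hP : VanishesTo p T₁ P) (hQ : VanishesTo p T₂ Q) :
    VanishesTo p (T₁ + T₂) (P * Q) := by
  obtain ⟨n, hn⟩ : ∃ n, n = T₁ + T₂ := ⟨_, rfl⟩
  rw [← hn]
  induction n generalizing T₁ T₂ P Q with
  | zero => exact vanishesTo_zero
  | succ n ih =>
    have hder : derivD (P * Q) = P * derivD Q + derivD P * Q := by
      rw [Derivation.leibniz, smul_eq_mul, smul_eq_mul, mul_comm Q]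
    rw [vanishesTo_succ, hder, map_mul]
    have hpred {S : ℕ} {R : MvPolynomial (Fin 3) ℂ} (h : VanishesTo p S R) :
        VanishesTo p (S - 1) (derivD R) := by
      cases S with
      | zero => exact vanishesTo_zero
      | succ S => exact (vanishesTo_succ.mp h).2
    have hz {S : ℕ} {R : MvPolynomial (Fin 3) ℂ} (hS : 0 < S) (h : VanishesTo p S R) :
        eval p R = 0 := h 0 hS
    constructor
    · rcases Nat.eq_zero_or_pos T₁ with h | h
      · rw [hz (by lia) hQ, mul_zero]
      · rw [hz h hP, zero_mul]
    · apply VanishesTo.add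
      · rcases Nat.eq_zero_or_pos T₂ with h | h
        · exact ih (T₁ := T₁ - 1) (T₂ := 0) (hP.mono (Nat.sub_le _ _)) vanishesTo_zero (by lia)
        · exact ih hP (hpred hQ) (by lia)
      · rcases Nat.eq_zero_or_pos T₁ with h | h
        · exact ih (T₁ := 0) (T₂ := T₂ - 1) vanishesTo_zero (hQ.mono (Nat.sub_le _ _)) (by lia)
        · exact ih (hpred hP) hQ (by lia)

lemma VanishesTo.mul_right (hP : VanishesTo p T P) (Q : MvPolynomial (Fin 3) ℂ) :
    VanishesTo p T (P * Q) :=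
  hP.mul (vanishesTo_zero (P := Q))

lemma VanishesTo.mul_left (hP : VanishesTo p T P) (Q : MvPolynomial (Fin 3) ℂ) :
    VanishesTo p T (Q * P) :=
  mul_comm P Q ▸ hP.mul_right Q

lemma VanishesTo.of_X_zero_pow_mul (hp : p 0 = 1) {m : ℕ}
    (h : VanishesTo p T (X 0 ^ m * P)) : VanishesTo p T P := by
  induction T generalizing P with
  | zero => exact vanishesTo_zero
  | succ T ih =>
    rw [vanishesTo_succ, derivD_X_zero_pow_mul] at h
    exact vanishesTo_succ.mpr ⟨by simpa [hp] using h.1, ih h.2⟩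

lemma VanishesTo.of_derivD_sub {c : ℂ} (h0 : eval p P = 0)
    (h : VanishesTo p T (derivD P - c • P)) : VanishesTo p (T + 1) P := by
  induction T with
  | zero => exact vanishesTo_succ.mpr ⟨h0, vanishesTo_zero⟩
  | succ T ih =>
    have hP := ih (h.mono T.le_succ)
    refine vanishesTo_succ.mpr ⟨h0, ?_⟩
    simpa using h.add (hP.smul c)

lemma VanishesTo.mem_Igam {ξ η : ℂ} {D : ℕ} (hP : P.IsHomogeneous D)
    (h : VanishesTo ![1, ξ, η] T P) : P ∈ Igam ξ η T :=
  Ideal.subset_span ⟨⟨D, hP⟩, by rw [DD_eq_derivD]; exact h⟩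

end VanishesTo

/-! ### Newton interpolation along the curve `(1 : z : exp z)` -/

lemma exists_interpolation_nodes (d : ℕ) : ∃ x : ℕ → ℕ, Monotone x ∧
    ∀ i n, i + n < (d + 1).choose 2 → x i = x (i + n) → n + x i < d := by
  induction d with
  | zero => exact ⟨fun _ => 0, monotone_const, fun i n h => by simp at h⟩
  | succ d ih =>
    obtain ⟨x, hx, hd⟩ := ih
    refine ⟨fun k => if k < d + 1 then 0 else x (k - (d + 1)) + 1, fun i j hij => ?_,
      fun i n hin h => ?_⟩
    · dsimp only
      split_ifs
      · exact le_rfl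
      · exact Nat.zero_le _
      · lia
      · exact Nat.succ_le_succ (hx (by lia))
    · have hc : (d + 1 + 1).choose 2 = (d + 1) + (d + 1).choose 2 := by
        rw [Nat.choose_succ_succ' (d + 1) 1, Nat.choose_one_right]
      dsimp only at h ⊢
      split_ifs at h ⊢ with h1 h2
      · lia
      · have := hd (i - (d + 1)) n (by lia)
          (by rw [← Nat.sub_add_comm (by lia)]; lia)
        lia

/-- The homogeneous polynomial of degree `d - 1` restricting to `z ^ n * exp (x * z) / n!` on the
curve `(1 : z : exp z)`. -/
noncomputable def expMonomial (d n x : ℕ) : MvPolynomial (Fin 3) ℂ :=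
  ((n.factorial : ℂ)⁻¹) • (X 0 ^ (d - 1 - n - x) * X 1 ^ n * X 2 ^ x)

lemma isHomogeneous_smul {P : MvPolynomial (Fin 3) ℂ} {D : ℕ} (c : ℂ) (hP : P.IsHomogeneous D) :
    (c • P).IsHomogeneous D :=
  (homogeneousSubmodule (Fin 3) ℂ D).smul_mem c hP

lemma isHomogeneous_expMonomial {d n x : ℕ} (h : n + x < d) :
    (expMonomial d n x).IsHomogeneous (d - 1) := by
  refine isHomogeneous_smul _ ?_
  have h' : d - 1 = (d - 1 - n - x) + n + x := by lia
  conv_rhs => rw [h']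
  exact ((isHomogeneous_X_pow _ _).mul (isHomogeneous_X_pow _ _)).mul (isHomogeneous_X_pow _ _)

lemma plen_expMonomial_le (d n x : ℕ) : plen (expMonomial d n x) ≤ 1 := by
  rw [expMonomial, plen_smul, norm_inv, Complex.norm_natCast, mul_assoc]
  have h1 : plen (X 0 ^ (d - 1 - n - x) * (X 1 ^ n * X 2 ^ x)) ≤ 1 := by
    refine (plen_X_pow_mul_le _ _ _).trans ((plen_X_pow_mul_le _ _ _).trans ?_)
    simpa using plen_pow_le (X 2) x
  have h2 : ((n.factorial : ℝ))⁻¹ ≤ 1 :=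
    inv_le_one_of_one_le₀ (by exact_mod_cast n.factorial_pos)
  exact mul_le_one₀ h2 (plen_nonneg _) h1

lemma derivD_expMonomial_zero (d x : ℕ) :
    derivD (expMonomial d 0 x) = (x : ℂ) • expMonomial d 0 x := by
  simp only [expMonomial, pow_zero, mul_one, Derivation.map_smul, derivD_X_zero_pow_mul,
    Derivation.leibniz_pow, derivD_X_two, smul_eq_mul]
  rcases x with _ | x
  · simp
  · simp only [Nat.add_sub_cancel, ← pow_succ, ← Nat.cast_smul_eq_nsmul ℂ, mul_smul_comm]
    rw [smul_comm]

lemma derivD_expMonomial_succ {d n x : ℕ} (h : n + 1 + x < d) :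
    derivD (expMonomial d (n + 1) x) = (x : ℂ) • expMonomial d (n + 1) x + expMonomial d n x := by
  have h2 : derivD (X 2 ^ x) = (x : ℂ) • X 2 ^ x := by
    rcases x with _ | x
    · simp
    · simp [Derivation.leibniz_pow, ← pow_succ, ← Nat.cast_smul_eq_nsmul ℂ]
  have h1 : derivD (X 1 ^ (n + 1)) = ((n + 1 : ℕ) : ℂ) • (X 1 ^ n * X 0) := by
    simp [Derivation.leibniz_pow, ← Nat.cast_smul_eq_nsmul ℂ]
  have h0 : d - 1 - n - x = (d - 1 - (n + 1) - x) + 1 := by lia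
  have hf : (((n + 1).factorial : ℂ))⁻¹ * ((n + 1 : ℕ) : ℂ) = (n.factorial : ℂ)⁻¹ := by
    rw [Nat.factorial_succ]
    have := Nat.cast_ne_zero (R := ℂ).mpr n.factorial_ne_zero
    have := Nat.cast_ne_zero (R := ℂ).mpr n.succ_ne_zero
    push_cast at *
    field_simp
  rw [expMonomial, expMonomial, Derivation.map_smul, mul_assoc, derivD_X_zero_pow_mul,
    Derivation.leibniz, h1, h2, h0, ← hf]
  simp only [smul_eq_mul, MvPolynomial.smul_eq_C_mul, map_mul]
  ring

/-- The homogeneous polynomial of degree `d - 1` restricting on the curve `(1 : z : exp z)` to the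
divided difference of `x ↦ exp (x * z)` at the nodes `x i, …, x (i + n)`. -/
noncomputable def dividedDiff (d : ℕ) (x : ℕ → ℕ) : ℕ → ℕ → MvPolynomial (Fin 3) ℂ
  | 0, i => expMonomial d 0 (x i)
  | n + 1, i =>
    if x i = x (i + (n + 1)) then expMonomial d (n + 1) (x i)
    else ((x (i + (n + 1)) : ℂ) - x i)⁻¹ • (dividedDiff d x n (i + 1) - dividedDiff d x n i)

section dividedDiff

variable {d : ℕ} {x : ℕ → ℕ}

lemma dividedDiff_of_eq {i n : ℕ} (h : x i = x (i + n)) :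
    dividedDiff d x n i = expMonomial d n (x i) := by
  cases n with
  | zero => rfl
  | succ n => rw [dividedDiff, if_pos h]

lemma smul_dividedDiff_succ (hx : Monotone x) (n i : ℕ) :
    ((x (i + (n + 1)) : ℂ) - x i) • dividedDiff d x (n + 1) i =
      dividedDiff d x n (i + 1) - dividedDiff d x n i := by
  by_cases h : x i = x (i + (n + 1))
  · have h1 : x i = x (i + 1) := le_antisymm (hx (by lia)) (h ▸ hx (by lia))
    have h2 : x i = x (i + n) := le_antisymm (hx (by lia)) (h ▸ hx (by lia))
    have h3 : x (i + 1) = x (i + 1 + n) := by rw [← h1, h]; congr 1; lia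
    rw [dividedDiff_of_eq h2, dividedDiff_of_eq h3, ← h, ← h1]
    simp
  · have h' : (x (i + (n + 1)) : ℂ) - x i ≠ 0 :=
      sub_ne_zero.mpr fun e => h (Nat.cast_injective e).symm
    rw [dividedDiff, if_neg h, smul_inv_smul₀ h']

lemma isHomogeneous_dividedDiff {M : ℕ}
    (hd : ∀ i n, i + n < M → x i = x (i + n) → n + x i < d) (n i : ℕ) (h : i + n < M) :
    (dividedDiff d x n i).IsHomogeneous (d - 1) := by
  induction n generalizing i with
  | zero => exact isHomogeneous_expMonomial (hd i 0 h rfl)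
  | succ n ih =>
    rw [dividedDiff]
    split_ifs with hi
    · exact isHomogeneous_expMonomial (hd i (n + 1) h hi)
    · exact isHomogeneous_smul _ ((ih (i + 1) (by lia)).sub (ih i (by lia)))

lemma plen_dividedDiff_le (hx : Monotone x) (n i : ℕ) :
    plen (dividedDiff d x n i) ≤ 2 ^ n := by
  induction n generalizing i with
  | zero => simpa [dividedDiff] using plen_expMonomial_le d 0 (x i)
  | succ n ih =>
    rw [dividedDiff]
    split_ifs with hi
    · exact (plen_expMonomial_le _ _ _).trans (one_le_pow₀ one_le_two)
    · have hlt : x i + 1 ≤ x (i + (n + 1)) := lt_of_le_of_ne (hx (by lia)) hi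
      have hc : ‖((x (i + (n + 1)) : ℂ) - x i)⁻¹‖ ≤ 1 := by
        rw [← Nat.cast_sub (by lia), norm_inv, Complex.norm_natCast]
        exact inv_le_one_of_one_le₀ (by exact_mod_cast Nat.le_sub_of_add_le' hlt)
      rw [plen_smul]
      calc _ ≤ (1 : ℝ) * (2 ^ n + 2 ^ n) := by
            refine mul_le_mul hc ?_ (plen_nonneg _) zero_le_one
            exact (plen_sub_le _ _).trans (add_le_add (ih _) (ih _))
        _ = 2 ^ (n + 1) := by ring

lemma derivD_dividedDiff_zero (i : ℕ) :
    derivD (dividedDiff d x 0 i) = (x i : ℂ) • dividedDiff d x 0 i :=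
  derivD_expMonomial_zero _ _

lemma derivD_dividedDiff_succ (hx : Monotone x) {M : ℕ}
    (hd : ∀ i n, i + n < M → x i = x (i + n) → n + x i < d) (n i : ℕ) (h : i + (n + 1) < M) :
    derivD (dividedDiff d x (n + 1) i) =
      (x i : ℂ) • dividedDiff d x (n + 1) i + dividedDiff d x n (i + 1) := by
  induction n generalizing i with
  | zero =>
    by_cases hi : x i = x (i + (0 + 1))
    · have := hd i (0 + 1) h hi
      rw [dividedDiff_of_eq hi, derivD_expMonomial_succ this, dividedDiff_of_eq rfl, hi]
    · have h' : (x (i + (0 + 1)) : ℂ) - x i ≠ 0 :=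
        sub_ne_zero.mpr fun e => hi (Nat.cast_injective e).symm
      apply smul_right_injective _ h'
      have e := smul_dividedDiff_succ (d := d) hx 0 i
      dsimp only
      rw [← Derivation.map_smul, smul_add, smul_comm, e, map_sub, derivD_dividedDiff_zero,
        derivD_dividedDiff_zero]
      simp only [smul_sub, sub_smul, zero_add]
      abel
  | succ n ih =>
    by_cases hi : x i = x (i + (n + 1 + 1))
    · have := hd i (n + 1 + 1) h hi
      have h1 : x i = x (i + 1) := le_antisymm (hx (by lia)) (hi ▸ hx (by lia))
      have h3 : x (i + 1) = x (i + 1 + (n + 1)) := by rw [← h1, hi]; congr 1; lia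
      rw [dividedDiff_of_eq hi, derivD_expMonomial_succ this, dividedDiff_of_eq h3, ← h1]
    · have h' : (x (i + (n + 1 + 1)) : ℂ) - x i ≠ 0 :=
        sub_ne_zero.mpr fun e => hi (Nat.cast_injective e).symm
      apply smul_right_injective _ h'
      have e := smul_dividedDiff_succ (d := d) hx (n + 1) i
      have e' := smul_dividedDiff_succ (d := d) hx n (i + 1)
      have hidx : i + 1 + (n + 1) = i + (n + 1 + 1) := by lia
      rw [hidx] at e'
      dsimp only
      rw [← Derivation.map_smul, smul_add, smul_comm, e, map_sub, ih (i + 1) (by lia),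
        ih i (by lia)]
      have e'' : dividedDiff d x n (i + 1 + 1) = dividedDiff d x n (i + 1) +
          ((x (i + (n + 1 + 1)) : ℂ) - x (i + 1)) • dividedDiff d x (n + 1) (i + 1) := by
        rw [e']; abel
      rw [e'']
      simp only [smul_sub, sub_smul]
      abel

lemma eval_dividedDiff_zero (i : ℕ) : eval ![1, 0, 1] (dividedDiff d x 0 i) = 1 := by
  simp [dividedDiff, expMonomial]

lemma eval_dividedDiff_succ (n i : ℕ) : eval ![1, 0, 1] (dividedDiff d x (n + 1) i) = 0 := by
  induction n generalizing i with
  | zero =>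
    rw [dividedDiff]
    split_ifs
    · simp [expMonomial]
    · simp [eval_dividedDiff_zero]
  | succ n ih =>
    rw [dividedDiff]
    split_ifs
    · simp [expMonomial]
    · simp [ih]

lemma exists_newton_coefficients (hx : Monotone x) {M : ℕ}
    (hd : ∀ i n, i + n < M → x i = x (i + n) → n + x i < d) {D : ℕ} (hD : D ≠ 0) (m t i : ℕ)
    (hi : i + t ≤ M) {P : MvPolynomial (Fin 3) ℂ} (hP : P.IsHomogeneous D) :
    ∃ c : ℕ → ℂ, (∀ k, ‖c k‖ ≤ (D + d : ℝ) ^ k * plen P) ∧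
      VanishesTo ![1, 0, 1] t
        (P - X 0 ^ m * ∑ k ∈ Finset.range t, c k • dividedDiff d x k i) := by
  induction t generalizing i P with
  | zero =>
    refine ⟨0, fun k => ?_, vanishesTo_zero⟩
    have := plen_nonneg P
    rw [Pi.zero_apply, norm_zero]
    positivity
  | succ t ih =>
    obtain ⟨c, hc, hv⟩ := ih (i + 1) (by lia)
      ((isHomogeneous_derivD hD hP).sub (isHomogeneous_smul (x i : ℂ) hP))
    have hxi : x i < d := by simpa using hd i 0 (by lia) rfl
    have hlen : plen (derivD P - (x i : ℂ) • P) ≤ (D + d) * plen P := by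
      refine (plen_sub_le _ _).trans ?_
      rw [plen_smul, Complex.norm_natCast, add_mul]
      refine add_le_add (plen_derivD_le hP) (mul_le_mul_of_nonneg_right ?_ (plen_nonneg _))
      exact_mod_cast hxi.le
    refine ⟨fun k => Nat.casesOn k (eval ![1, 0, 1] P) c, fun k => ?_, ?_⟩
    · cases k with
      | zero =>
        simpa using norm_eval_le_plen (p := ![1, 0, 1])
          (fun j => by fin_cases j <;> simp) P
      | succ k =>
        calc ‖c k‖ ≤ (D + d : ℝ) ^ k * ((D + d) * plen P) :=
              (hc k).trans (mul_le_mul_of_nonneg_left hlen (by positivity))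
          _ = _ := by ring
    · refine VanishesTo.of_derivD_sub (c := x i) ?_ ?_
      · simp [Finset.sum_range_succ', eval_dividedDiff_zero, eval_dividedDiff_succ]
      · convert hv using 1
        have hsum : derivD (∑ k ∈ Finset.range t, c k • dividedDiff d x (k + 1) i) =
            (x i : ℂ) • ∑ k ∈ Finset.range t, c k • dividedDiff d x (k + 1) i +
              ∑ k ∈ Finset.range t, c k • dividedDiff d x k (i + 1) := by
          rw [map_sum, Finset.smul_sum, ← Finset.sum_add_distrib]
          refine Finset.sum_congr rfl fun k hk => ?_
          rw [Derivation.map_smul,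
            derivD_dividedDiff_succ hx hd k i (by have := Finset.mem_range.mp hk; lia),
            smul_add, smul_comm]
        rw [Finset.sum_range_succ', map_sub, derivD_X_zero_pow_mul, map_add, hsum,
          Derivation.map_smul, derivD_dividedDiff_zero]
        simp only [MvPolynomial.smul_eq_C_mul]
        ring

end dividedDiff

lemma exists_interpolation {d D t : ℕ} (hd : d ≠ 0) (hdD : 3 * d ≤ D)
    (ht : t ≤ (d + 1).choose 2) {P : MvPolynomial (Fin 3) ℂ} (hP : P.IsHomogeneous D)
    (hlen : plen P ≤ 1) :
    ∃ R : MvPolynomial (Fin 3) ℂ, R.IsHomogeneous (d - 1) ∧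
      plen R ≤ (2 * (D + d) : ℝ) ^ t - 1 ∧
      VanishesTo ![1, 0, 1] t (P - X 0 ^ (D - (d - 1)) * R) := by
  obtain ⟨x, hx, hM⟩ := exists_interpolation_nodes d
  obtain ⟨c, hc, hv⟩ := exists_newton_coefficients hx hM (D := D) (by lia) (D - (d - 1)) t 0
    (by lia) hP
  refine ⟨_, ?_, ?_, hv⟩
  · refine IsHomogeneous.sum _ _ _ fun k hk => isHomogeneous_smul _ ?_
    exact isHomogeneous_dividedDiff hM k 0 (by have := Finset.mem_range.mp hk; lia)
  · have hA : (2 : ℝ) ≤ 2 * (D + d) := by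
      have : (1 : ℝ) ≤ D := by exact_mod_cast (by lia : 1 ≤ D)
      have : (0 : ℝ) ≤ d := Nat.cast_nonneg d
      linarith
    have hk (k : ℕ) : plen (c k • dividedDiff d x k 0) ≤ (2 * (D + d) : ℝ) ^ k := by
      rw [plen_smul, mul_pow, mul_comm]
      refine mul_le_mul (plen_dividedDiff_le hx k 0) ((hc k).trans ?_) (norm_nonneg _)
        (by positivity)
      exact mul_le_of_le_one_right (by positivity) hlen
    refine ((plen_sum_le _ _).trans (Finset.sum_le_sum fun k _ => hk k)).trans ?_
    have hg := geom_sum_mul (2 * (D + d) : ℝ) t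
    rw [← hg]
    exact le_mul_of_one_le_right (Finset.sum_nonneg fun _ _ => by positivity) (by linarith)

/-! ### The estimate at the identity of the group -/

lemma exists_large_value_add {d D N : ℕ} (hd : d ≠ 0) (hdD : 3 * d ≤ D) (hDN : D ≤ N)
    (hN : 15 ≤ N) {t₁ t₂ : ℕ} (ht0 : t₁ + t₂ ≠ 0) (ht : t₁ + t₂ ≤ (d + 1).choose 2)
    {p : Fin 3 → ℂ} (hp : ∀ i, ‖p i‖ ≤ 1) {P Q : MvPolynomial (Fin 3) ℂ}
    (hP : P.IsHomogeneous D) (hQ : Q.IsHomogeneous D) (hP1 : plen P ≤ 1) (hQ1 : plen Q ≤ 1)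
    (hPv : VanishesTo ![1, 0, 1] t₁ P) (hQv : VanishesTo ![1, 0, 1] t₂ Q) :
    ∃ S : MvPolynomial (Fin 3) ℂ, S.IsHomogeneous D ∧ plen S ≤ 1 ∧
      VanishesTo ![1, 0, 1] (t₁ + t₂) S ∧
      ‖eval p P‖ * ‖eval p Q‖ ≤ (N : ℝ) ^ (3 * (t₁ + t₂)) * ‖eval p S‖ := by
  set t := t₁ + t₂ with htdef
  obtain ⟨R₁, hR₁, hR₁len, hR₁v⟩ := exists_interpolation hd hdD ht hP hP1
  obtain ⟨R₂, hR₂, hR₂len, hR₂v⟩ := exists_interpolation hd hdD ht hQ hQ1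
  set r : ℝ := (2 * (D + d) : ℝ) ^ t - 1 with hr
  have hr0 : 0 ≤ r := (plen_nonneg _).trans hR₁len
  set K : ℝ := (N : ℝ) ^ (3 * t) with hK
  have hKr : 2 * (1 + r) ^ 2 ≤ K := by
    have hA : (2 * (D + d) : ℝ) ≤ 8 / 3 * N := by
      have h1 : (3 * d : ℝ) ≤ D := by exact_mod_cast hdD
      have h2 : (D : ℝ) ≤ N := by exact_mod_cast hDN
      linarith
    have hN' : (15 : ℝ) ≤ N := by exact_mod_cast hN
    have h2 : (2 : ℝ) ≤ 2 ^ t := le_self_pow₀ one_le_two ht0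
    calc 2 * (1 + r) ^ 2 = 2 * ((2 * (D + d) : ℝ) ^ t) ^ 2 := by rw [hr]; ring
      _ ≤ 2 ^ t * ((8 / 3 * N : ℝ) ^ t) ^ 2 := by gcongr
      _ = (2 * (8 / 3 * N) ^ 2 : ℝ) ^ t := by rw [mul_pow 2, ← pow_mul, ← pow_mul, mul_comm t 2]
      _ ≤ ((N : ℝ) ^ 3) ^ t := by
        refine pow_le_pow_left₀ (by positivity) ?_ t
        nlinarith [sq_nonneg (N : ℝ)]
      _ = K := by rw [hK, pow_mul]
  have hK0 : 0 < K := by have := sq_nonneg (1 + r); nlinarith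
  set m := D - (d - 1) with hm
  have hXR {R : MvPolynomial (Fin 3) ℂ} (hR : R.IsHomogeneous (d - 1)) :
      (X 0 ^ m * R).IsHomogeneous D := by
    have := (isHomogeneous_X_pow (R := ℂ) (0 : Fin 3) m).mul hR
    rwa [hm, Nat.sub_add_cancel (by lia)] at this
  set E₁ := P - X 0 ^ m * R₁ with hE₁
  set E₂ := Q - X 0 ^ m * R₂ with hE₂
  set S := X 0 ^ (m - (d - 1)) * (R₁ * R₂) with hS
  have hS_hom : S.IsHomogeneous D := by
    have := (isHomogeneous_X_pow (R := ℂ) (0 : Fin 3) (m - (d - 1))).mul (hR₁.mul hR₂)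
    rwa [show m - (d - 1) + (d - 1 + (d - 1)) = D by lia] at this
  have hdecomp : P * Q = P * E₂ + X 0 ^ m * R₂ * E₁ + X 0 ^ D * S := by
    have hpow : (X 0 : MvPolynomial (Fin 3) ℂ) ^ D * X 0 ^ (m - (d - 1)) = X 0 ^ m * X 0 ^ m := by
      rw [← pow_add, ← pow_add]; congr 1; lia
    rw [hS, hE₁, hE₂, ← mul_assoc, hpow]
    ring
  have hSv : VanishesTo ![1, 0, 1] t S := by
    refine VanishesTo.of_X_zero_pow_mul (m := D) rfl ?_
    have h := ((hPv.mul hQv).sub (hR₂v.mul_left P)).sub (hR₁v.mul_left (X 0 ^ m * R₂))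
    convert h using 1
    rw [hdecomp]
    ring
  have hE {R P : MvPolynomial (Fin 3) ℂ} (hR : plen R ≤ r) (hP : plen P ≤ 1) :
      plen (P - X 0 ^ m * R) ≤ 1 + r :=
    (plen_sub_le _ _).trans (add_le_add hP ((plen_X_pow_mul_le _ _ _).trans hR))
  have hS_len : plen S ≤ r * r := (plen_X_pow_mul_le _ _ _).trans
    ((plen_mul_le _ _).trans (mul_le_mul hR₁len hR₂len (plen_nonneg _) hr0))
  by_contra! hcon
  set V := ‖eval p P‖ * ‖eval p Q‖ with hV
  have hV0 : 0 < V := by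
    have := hcon 0 (isHomogeneous_zero _ _ _) (by simp) (fun i _ => by simp)
    simpa using this
  have hsmall {F : MvPolynomial (Fin 3) ℂ} {c : ℝ} (hF : F.IsHomogeneous D) (hc : plen F ≤ c)
      (hv : VanishesTo ![1, 0, 1] t F) : ‖eval p F‖ ≤ c * (V / K) := by
    rcases (plen_nonneg F).eq_or_lt with h0 | h0
    · exact ((norm_eval_le_plen hp F).trans h0.symm.le).trans
        (mul_nonneg ((plen_nonneg F).trans hc) (by positivity))
    · have hs : ‖((plen F : ℂ))⁻¹‖ = (plen F)⁻¹ := by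
        rw [norm_inv, Complex.norm_real, Real.norm_of_nonneg h0.le]
      have h := hcon (((plen F : ℂ))⁻¹ • F) (isHomogeneous_smul _ hF)
        (by rw [plen_smul, hs, inv_mul_cancel₀ h0.ne']) (hv.smul _)
      rw [smul_eval, norm_mul, hs] at h
      refine le_trans ?_ (mul_le_mul_of_nonneg_right hc (by positivity))
      have h' : (plen F)⁻¹ * ‖eval p F‖ ≤ V / K := by
        rw [le_div_iff₀ hK0, mul_comm]; exact h.le
      rwa [inv_mul_le_iff₀ h0] at h'
  have hX0 (n : ℕ) : ‖p 0‖ ^ n ≤ 1 := pow_le_one₀ (norm_nonneg _) (hp 0)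
  have h1 := hsmall (hP.sub (hXR hR₁)) (hE hR₁len hP1) hR₁v
  have h2 := hsmall (hQ.sub (hXR hR₂)) (hE hR₂len hQ1) hR₂v
  have h3 := hsmall hS_hom hS_len hSv
  have hP' : ‖eval p P‖ ≤ 1 := (norm_eval_le_plen hp P).trans hP1
  have hR' : ‖p 0‖ ^ m * ‖eval p R₂‖ ≤ r :=
    (mul_le_of_le_one_left (norm_nonneg _) (hX0 m)).trans
      ((norm_eval_le_plen hp R₂).trans hR₂len)
  have hVle : V ≤ ‖eval p E₂‖ + r * ‖eval p E₁‖ + ‖eval p S‖ := by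
    rw [hV, ← norm_mul, ← map_mul, hdecomp, map_add, map_add]
    refine (norm_add₃_le).trans ?_
    simp only [map_mul, norm_mul, map_pow, norm_pow, eval_X]
    gcongr
    · exact mul_le_of_le_one_left (norm_nonneg _) hP'
    · exact mul_le_of_le_one_left (norm_nonneg _) (hX0 D)
  have hlt : (1 + r) + r * (1 + r) + r * r < K := by nlinarith
  have hfin : V ≤ ((1 + r) + r * (1 + r) + r * r) * (V / K) := by
    have := mul_le_mul_of_nonneg_left h1 hr0
    linarith
  have hlt' := mul_lt_mul_of_pos_right hlt (div_pos hV0 hK0)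
  rw [mul_div_cancel₀ _ hK0.ne'] at hlt'
  linarith

lemma exists_large_value {d D N : ℕ} (hd : d ≠ 0) (hdD : 3 * d ≤ D) (hDN : D ≤ N)
    (hN : 15 ≤ N) {p : Fin 3 → ℂ} (hp : ∀ i, ‖p i‖ ≤ 1) {ρ : ℝ} (hρ : 0 ≤ ρ)
    {P₁ : MvPolynomial (Fin 3) ℂ} (hP₁ : P₁.IsHomogeneous D) (hP₁len : plen P₁ ≤ 1)
    (hP₁v : VanishesTo ![1, 0, 1] 1 P₁) (hρP₁ : ρ ≤ ‖eval p P₁‖) (t : ℕ) (ht0 : t ≠ 0)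
    (ht : t ≤ (d + 1).choose 2) :
    ∃ P : MvPolynomial (Fin 3) ℂ, P.IsHomogeneous D ∧ plen P ≤ 1 ∧
      VanishesTo ![1, 0, 1] t P ∧ ρ ^ t ≤ (N : ℝ) ^ (3 * t * Nat.clog 2 t) * ‖eval p P‖ := by
  induction t using Nat.strong_induction_on with
  | _ t ih =>
  rcases Nat.lt_or_ge t 2 with h1 | h2
  · obtain rfl : t = 1 := by lia
    exact ⟨P₁, hP₁, hP₁len, hP₁v, by simpa using hρP₁⟩
  have hN1 : (1 : ℝ) ≤ N := by exact_mod_cast (by lia : 1 ≤ N)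
  obtain ⟨P, hP, hPlen, hPv, hPval⟩ := ih (t / 2) (by lia) (by lia) (by lia)
  obtain ⟨Q, hQ, hQlen, hQv, hQval⟩ := ih ((t + 1) / 2) (by lia) (by lia) (by lia)
  have hsum : t / 2 + (t + 1) / 2 = t := by lia
  obtain ⟨S, hS, hSlen, hSv, hSval⟩ := exists_large_value_add hd hdD hDN hN
    (by lia) (by lia) hp hP hQ hPlen hQlen hPv hQv
  rw [hsum] at hSv hSval
  refine ⟨S, hS, hSlen, hSv, ?_⟩
  set c := Nat.clog 2 ((t + 1) / 2) with hc
  have hct : Nat.clog 2 t = c + 1 := Nat.clog_of_two_le one_lt_two h2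
  have hmono : Nat.clog 2 (t / 2) ≤ c := Nat.clog_mono_right 2 (by lia)
  calc ρ ^ t = ρ ^ (t / 2) * ρ ^ ((t + 1) / 2) := by rw [← pow_add, hsum]
    _ ≤ ((N : ℝ) ^ (3 * (t / 2) * c) * ‖eval p P‖) *
          ((N : ℝ) ^ (3 * ((t + 1) / 2) * c) * ‖eval p Q‖) := by
        refine mul_le_mul (hPval.trans ?_) hQval (by positivity) (by positivity)
        gcongr
    _ = (N : ℝ) ^ (3 * t * c) * (‖eval p P‖ * ‖eval p Q‖) := by
        conv_rhs => rw [← hsum, mul_add, add_mul, pow_add]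
        ring
    _ ≤ (N : ℝ) ^ (3 * t * c) * ((N : ℝ) ^ (3 * t) * ‖eval p S‖) := by gcongr
    _ = (N : ℝ) ^ (3 * t * Nat.clog 2 t) * ‖eval p S‖ := by
        rw [hct, mul_add, mul_one, pow_add]; ring

lemma pow_clog_le_rpow {N : ℕ} (hN : 15 ≤ N) :
    (N : ℝ) ^ (3 * N * Nat.clog 2 N) ≤ (N : ℝ) ^ (6 * (N : ℝ) * Real.log N) := by
  have hN' : (15 : ℝ) ≤ N := by exact_mod_cast hN
  have h2 : (2 : ℝ) ≤ Real.log N := by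
    rw [Real.le_log_iff_exp_le (by linarith)]
    have h := Real.exp_one_lt_d9
    have he : Real.exp 2 = Real.exp 1 * Real.exp 1 := by rw [← Real.exp_add]; norm_num
    have := Real.exp_pos 1
    nlinarith
  have hclog : (Nat.clog 2 N : ℝ) ≤ 2 * Real.log N := by
    have hpos : Nat.clog 2 N ≠ 0 := (Nat.clog_pos one_lt_two (by lia)).ne'
    have hlt := Nat.pow_pred_clog_lt_self one_lt_two (x := N) (by lia)
    have hlt' : (2 : ℝ) ^ (Nat.clog 2 N).pred ≤ N := by exact_mod_cast hlt.le
    have hlog := Real.log_le_log (by positivity) hlt'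
    rw [Real.log_pow] at hlog
    have hcast : ((Nat.clog 2 N).pred : ℝ) = Nat.clog 2 N - 1 := by
      rw [Nat.pred_eq_sub_one, Nat.cast_sub (by lia)]; simp
    rw [hcast] at hlog
    have hl2 := Real.log_two_gt_d9
    by_contra! hcon
    nlinarith
  rw [← Real.rpow_natCast]
  refine Real.rpow_le_rpow_of_exponent_le (by linarith) ?_
  push_cast
  nlinarith

/-! ### Translation -/

/-- The inverse of the translation `tauG ξ η`. -/
noncomputable def tauGInv (ξ η : ℂ) : MvPolynomial (Fin 3) ℂ →ₐ[ℂ] MvPolynomial (Fin 3) ℂ :=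
  aeval ![X 0, X 1 - C ξ * X 0, C η⁻¹ * X 2]

lemma eval_tauGInv (ξ η : ℂ) (p : Fin 3 → ℂ) (P : MvPolynomial (Fin 3) ℂ) :
    eval p (tauGInv ξ η P) = eval ![p 0, p 1 - ξ * p 0, η⁻¹ * p 2] P := by
  rw [tauGInv, aeval_def]
  induction P using MvPolynomial.induction_on with
  | C a => simp
  | add P Q hP hQ => simp_all
  | mul_X P i hP =>
    rw [eval₂_mul, map_mul, hP, map_mul]
    fin_cases i <;> simp

lemma derivD_tauGInv (ξ η : ℂ) (P : MvPolynomial (Fin 3) ℂ) :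
    derivD (tauGInv ξ η P) = tauGInv ξ η (derivD P) := by
  induction P using MvPolynomial.induction_on with
  | C a => simp [tauGInv, ← MvPolynomial.algebraMap_eq]
  | add P Q hP hQ => simp_all
  | mul_X P i hP =>
    have hX : derivD (tauGInv ξ η (X i)) = tauGInv ξ η (derivD (X i)) := by
      have hC (a : ℂ) : derivD (C a) = 0 := derivD.map_algebraMap a
      fin_cases i <;> simp [tauGInv, hC]
    simp only [Derivation.leibniz, map_mul, map_add, smul_eq_mul, hP, hX]

lemma VanishesTo.tauGInv {ξ η : ℂ} (hη : η ≠ 0) {T : ℕ} {P : MvPolynomial (Fin 3) ℂ}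
    (h : VanishesTo ![1, 0, 1] T P) : VanishesTo ![1, ξ, η] T (tauGInv ξ η P) := by
  induction T generalizing P with
  | zero => exact vanishesTo_zero
  | succ T ih =>
    rw [vanishesTo_succ] at h ⊢
    refine ⟨?_, derivD_tauGInv ξ η P ▸ ih h.2⟩
    rw [eval_tauGInv]
    simpa [hη] using h.1

lemma isHomogeneous_tauGInv (ξ η : ℂ) {P : MvPolynomial (Fin 3) ℂ} {D : ℕ}
    (hP : P.IsHomogeneous D) : (tauGInv ξ η P).IsHomogeneous D := by
  have h := hP.aeval (n := 1) (τ := Fin 3) ![X 0, X 1 - C ξ * X 0, C η⁻¹ * X 2] fun i => by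
    have hC (a : ℂ) (j : Fin 3) : (C a * X j : MvPolynomial (Fin 3) ℂ).IsHomogeneous 1 := by
      simpa using (isHomogeneous_C (Fin 3) a).mul (isHomogeneous_X ℂ j)
    fin_cases i
    · exact isHomogeneous_X ℂ _
    · exact (isHomogeneous_X ℂ _).sub (hC _ _)
    · exact hC _ _
  rwa [one_mul] at h

lemma plen_tauGInv_le (ξ η : ℂ) {P : MvPolynomial (Fin 3) ℂ} {D : ℕ}
    (hP : P.IsHomogeneous D) :
    plen (tauGInv ξ η P) ≤ (1 + ‖ξ‖ + ‖η‖⁻¹) ^ D * plen P := by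
  set κ := 1 + ‖ξ‖ + ‖η‖⁻¹ with hκ
  have hξ := norm_nonneg ξ
  have hη := inv_nonneg.mpr (norm_nonneg η)
  refine plen_linearMap_le (tauGInv ξ η).toLinearMap P _ fun v hv => ?_
  have hX (i : Fin 3) : plen (tauGInv ξ η (X i)) ≤ κ := by
    have h1 : plen (X 1 - C ξ * X 0) ≤ 1 + ‖ξ‖ := by
      have := (plen_sub_le (X 1) (C ξ * X 0)).trans (add_le_add_right (plen_mul_le _ _) _)
      simpa using this
    have h2 : plen (C η⁻¹ * X 2) ≤ ‖η‖⁻¹ := by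
      simpa using plen_mul_le (C η⁻¹) (X 2)
    fin_cases i
    · simp [tauGInv]; linarith
    · simp [tauGInv]; linarith
    · simp [tauGInv] at h2 ⊢; linarith
  have hpow (i : Fin 3) : plen (tauGInv ξ η (X i) ^ v i) ≤ κ ^ v i :=
    (plen_pow_le _ _).trans (pow_le_pow_left₀ (plen_nonneg _) (hX i) _)
  have hmon : tauGInv ξ η (monomial v 1) =
      tauGInv ξ η (X 0) ^ v 0 * (tauGInv ξ η (X 1) ^ v 1 * tauGInv ξ η (X 2) ^ v 2) := by
    rw [tauGInv, aeval_monomial, Finsupp.prod_fintype _ _ (by simp), Fin.prod_univ_three]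
    simp [mul_assoc]
  have hsum := hP.sum_eq_of_mem_support hv
  rw [Fin.sum_univ_three] at hsum
  rw [AlgHom.toLinearMap_apply, hmon, ← hsum, add_assoc, pow_add, pow_add]
  have hκ0 : 0 ≤ κ := by positivity
  refine (plen_mul_le _ _).trans (mul_le_mul (hpow 0) ?_ (plen_nonneg _) (by positivity))
  exact (plen_mul_le _ _).trans
    (mul_le_mul (hpow 1) (hpow 2) (plen_nonneg _) (by positivity))

lemma norm_eval_le_Isup {ξ η : ℂ} {T D : ℕ} {p : Fin 3 → ℂ} (hp : ∀ i, ‖p i‖ ≤ 1)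
    {P : MvPolynomial (Fin 3) ℂ} (hP : P ∈ Igam ξ η T) (hPD : P.IsHomogeneous D)
    (hP1 : pnorm P ≤ 1) : ‖eval p P‖ ≤ Isup ξ η T D p := by
  refine le_csSup ⟨((Finset.univ : Finset (Fin 3)).finsuppAntidiag D).card, ?_⟩
    ⟨P, hP, hPD, hP1, rfl⟩
  rintro _ ⟨Q, -, hQ, hQ1, rfl⟩
  exact ((norm_eval_le_plen hp Q).trans (plen_le_card_mul_pnorm hQ)).trans
    (mul_le_of_le_one_right (Nat.cast_nonneg _) hQ1)

lemma exists_large_value_one {D : ℕ} (hD : D ≠ 0) {p : Fin 3 → ℂ} {k : Fin 3}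
    (hk : ‖p k‖ = 1) :
    ∃ P : MvPolynomial (Fin 3) ℂ, P.IsHomogeneous D ∧ plen P ≤ 1 ∧
      VanishesTo ![1, 0, 1] 1 P ∧ max ‖p 1‖ ‖p 2 - p 0‖ / 2 ≤ ‖eval p P‖ := by
  have key (L : MvPolynomial (Fin 3) ℂ) (hL : L.IsHomogeneous 1) (hlen : plen L ≤ 1)
      (h0 : eval ![1, 0, 1] L = 0) (hv : max ‖p 1‖ ‖p 2 - p 0‖ / 2 ≤ ‖eval p L‖) :
      ∃ P : MvPolynomial (Fin 3) ℂ, P.IsHomogeneous D ∧ plen P ≤ 1 ∧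
        VanishesTo ![1, 0, 1] 1 P ∧ max ‖p 1‖ ‖p 2 - p 0‖ / 2 ≤ ‖eval p P‖ := by
    refine ⟨X k ^ (D - 1) * L, ?_, (plen_X_pow_mul_le _ _ _).trans hlen, ?_, ?_⟩
    · have := (isHomogeneous_X_pow (R := ℂ) k (D - 1)).mul hL
      rwa [Nat.sub_add_cancel (Nat.one_le_iff_ne_zero.mpr hD)] at this
    · exact vanishesTo_succ.mpr ⟨by simp [h0], vanishesTo_zero⟩
    · simpa [hk] using hv
  rcases le_total ‖p 2 - p 0‖ ‖p 1‖ with h | h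
  · refine key (X 1) (isHomogeneous_X ℂ 1) (plen_X 1).le (by simp) ?_
    rw [max_eq_left h, eval_X]
    linarith [norm_nonneg (p 1)]
  · refine key ((1 / 2 : ℂ) • (X 2 - X 0))
      (isHomogeneous_smul _ ((isHomogeneous_X ℂ 2).sub (isHomogeneous_X ℂ 0))) ?_ (by simp) ?_
    · have := plen_sub_le (X 2) (X 0)
      rw [plen_X, plen_X] at this
      rw [plen_smul]
      norm_num
      linarith
    · rw [max_eq_right h, smul_eval, norm_mul]
      simp
      linarith

lemma eval_smul_of_isHomogeneous {P : MvPolynomial (Fin 3) ℂ} {D : ℕ} (hP : P.IsHomogeneous D)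
    (c : ℂ) (p : Fin 3 → ℂ) : eval (c • p) P = c ^ D * eval p P := by
  rw [eval_eq', eval_eq', Finset.mul_sum]
  refine Finset.sum_congr rfl fun v hv => ?_
  rw [← hP.sum_eq_of_mem_support hv, ← Finset.univ.prod_pow_eq_pow_sum]
  simp only [Pi.smul_apply, smul_eq_mul, mul_pow, Finset.prod_mul_distrib]
  ring

lemma pdist_le (ξ η α₀ α₁ α₂ : ℂ) (hη : η ≠ 0) :
    pdist ξ η α₀ α₁ α₂ ≤ (1 + ‖ξ‖) * max ‖α₁ - ξ * α₀‖ ‖η⁻¹ * α₂ - α₀‖ := by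
  set M := max ‖α₁ - ξ * α₀‖ ‖η⁻¹ * α₂ - α₀‖ with hM
  have hM1 : ‖α₁ - ξ * α₀‖ ≤ M := le_max_left _ _
  have hM2 : ‖η⁻¹ * α₂ - α₀‖ ≤ M := le_max_right _ _
  have hM0 : 0 ≤ M := (norm_nonneg _).trans hM1
  have hc1 : 1 ≤ c2c ξ η := le_max_left _ _
  have hcη : ‖η‖ ≤ c2c ξ η := (le_max_right _ _).trans (le_max_right _ _)
  have hξ := norm_nonneg ξ
  have hle : M ≤ (1 + ‖ξ‖) * M := le_mul_of_one_le_left hM0 (by linarith)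
  rw [pdist, inv_mul_le_iff₀ (by linarith)]
  refine max_le ?_ (max_le ?_ ?_)
  · rw [mul_comm α₀]
    exact (hM1.trans hle).trans (le_mul_of_one_le_left (by positivity) hc1)
  · have : α₂ - α₀ * η = η * (η⁻¹ * α₂ - α₀) := by field_simp
    rw [this, norm_mul]
    exact mul_le_mul hcη (hM2.trans hle) (norm_nonneg _) (by linarith)
  · have : α₁ * η - α₂ * ξ = η * ((α₁ - ξ * α₀) - ξ * (η⁻¹ * α₂ - α₀)) := by
      field_simp
      ring
    rw [this, norm_mul]
    refine mul_le_mul hcη ((norm_sub_le _ _).trans ?_) (norm_nonneg _) (by linarith)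
    rw [norm_mul, add_mul, one_mul]
    exact add_le_add hM1 (mul_le_mul_of_nonneg_left hM2 hξ)

lemma le_c5c (ξ η : ℂ) :
    2 * (1 + ‖ξ‖) * (1 + ‖ξ‖ + ‖η‖⁻¹) ≤ c5c ξ η := by
  have hc1 : 1 ≤ c2c ξ η := le_max_left _ _
  have hξ := norm_nonneg ξ
  have hη := inv_nonneg.mpr (norm_nonneg η)
  have hc3 : 2 + ‖ξ‖ + ‖η‖⁻¹ ≤ c3c ξ η := le_mul_of_one_le_right (by positivity) hc1
  rw [c5c, sq, mul_assoc]
  gcongr <;> linarith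

theorem stmt13 (ξ η : ℂ) (hη : η ≠ 0) (D T : ℕ) (hD : 3 ≤ D) (hDT : D ≤ T)
    (hT2 : T ≤ Nat.choose (D / 3 + 1) 2)
    (α₀ α₁ α₂ : ℂ) (hα : max ‖α₀‖ (max ‖α₁‖ ‖α₂‖) = 1) :
    pdist ξ η α₀ α₁ α₂ ^ T ≤
      c5c ξ η ^ T * (T : ℝ) ^ (6 * (T : ℝ) * Real.log T) * Isup ξ η T D ![α₀, α₁, α₂] := by

  have hd : D / 3 ≠ 0 := by lia
  have hT15 : 15 ≤ T := by
    rw [Nat.choose_two_right, Nat.add_sub_cancel, Nat.le_div_iff_mul_le two_pos] at hT2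
    have h5 : 5 ≤ D / 3 := by
      have h6 : 6 * (D / 3) ≤ (D / 3 + 1) * (D / 3) := by lia
      have := Nat.le_of_mul_le_mul_right h6 (Nat.pos_of_ne_zero hd)
      lia
    lia
  have hξ := norm_nonneg ξ
  have hη' := inv_nonneg.mpr (norm_nonneg η)
  set κ := 1 + ‖ξ‖ + ‖η‖⁻¹ with hκ
  have hα₀ : ‖α₀‖ ≤ 1 := hα ▸ le_max_left _ _
  have hα₁ : ‖α₁‖ ≤ 1 := hα ▸ (le_max_left _ _).trans (le_max_right _ _)
  have hα₂ : ‖α₂‖ ≤ 1 := hα ▸ (le_max_right _ _).trans (le_max_right _ _)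
  have hαi (i : Fin 3) : ‖![α₀, α₁, α₂] i‖ ≤ 1 := by fin_cases i <;> assumption
  set β : Fin 3 → ℂ := ![α₀, α₁ - ξ * α₀, η⁻¹ * α₂] with hβ
  obtain ⟨k, hk⟩ := Finite.exists_max fun i => ‖β i‖
  set a := ‖β k‖ with ha
  have ha0 : 0 < a := by
    refine (norm_nonneg _).lt_of_ne fun h => ?_
    have hz (i : Fin 3) : β i = 0 := norm_le_zero_iff.mp ((hk i).trans h.symm.le)
    have h0 : α₀ = 0 := hz 0
    have h1 : α₁ - ξ * α₀ = 0 := hz 1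
    have h2 : η⁻¹ * α₂ = 0 := hz 2
    simp_all
  have haκ : a ≤ κ := by
    have h (i : Fin 3) : ‖β i‖ ≤ κ := by
      fin_cases i
      · change ‖α₀‖ ≤ κ
        linarith
      · change ‖α₁ - ξ * α₀‖ ≤ κ
        have h1 := norm_sub_le α₁ (ξ * α₀)
        rw [norm_mul] at h1
        have h2 := mul_le_of_le_one_right hξ hα₀
        linarith
      · change ‖η⁻¹ * α₂‖ ≤ κ
        rw [norm_mul, norm_inv]
        have h2 := mul_le_of_le_one_right hη' hα₂
        linarith
    exact h k
  have hκ1 : 1 ≤ κ := by linarith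
  set p : Fin 3 → ℂ := (a : ℂ)⁻¹ • β with hp
  have hpi (i : Fin 3) : ‖p i‖ = a⁻¹ * ‖β i‖ := by
    simp [hp, abs_of_pos ha0]
  have hp1 (i : Fin 3) : ‖p i‖ ≤ 1 := by
    rw [hpi, inv_mul_le_iff₀ ha0, mul_one]
    exact hk i
  have hpk : ‖p k‖ = 1 := by rw [hpi, inv_mul_cancel₀ ha0.ne']
  obtain ⟨P₁, hP₁, hP₁len, hP₁v, hP₁val⟩ :=
    exists_large_value_one (D := D) (by lia) hpk
  set ρ := max ‖p 1‖ ‖p 2 - p 0‖ / 2 with hρ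
  have hρ0 : 0 ≤ ρ := by positivity
  obtain ⟨Q, hQ, hQlen, hQv, hQval⟩ := exists_large_value hd (by lia) hDT hT15 hp1 hρ0 hP₁
    hP₁len hP₁v hP₁val T (by lia) hT2
  set B := (T : ℝ) ^ (3 * T * Nat.clog 2 T) with hB
  have hdist : pdist ξ η α₀ α₁ α₂ ≤ 2 * (1 + ‖ξ‖) * a * ρ := by
    refine (pdist_le ξ η α₀ α₁ α₂ hη).trans (le_of_eq ?_)
    have h1 : ‖α₁ - ξ * α₀‖ = a * ‖p 1‖ := by
      rw [hpi, mul_inv_cancel_left₀ ha0.ne']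
      rfl
    have h2 : ‖η⁻¹ * α₂ - α₀‖ = a * ‖p 2 - p 0‖ := by
      have : p 2 - p 0 = (a : ℂ)⁻¹ * (η⁻¹ * α₂ - α₀) := by
        simp [hp, hβ]
        ring
      rw [this, norm_mul, norm_inv, Complex.norm_real, Real.norm_of_nonneg ha0.le,
        mul_inv_cancel_left₀ ha0.ne']
    rw [h1, h2, ← mul_max_of_nonneg _ _ ha0.le, hρ]
    ring
  have hdist0 : 0 ≤ pdist ξ η α₀ α₁ α₂ := by
    have hc1 : 1 ≤ c2c ξ η := le_max_left _ _
    rw [pdist]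
    positivity
  have hQα : a ^ D * ‖eval p Q‖ ≤ κ ^ D * Isup ξ η T D ![α₀, α₁, α₂] := by
    have hκD : 0 < κ ^ D := by positivity
    have hev : eval ![α₀, α₁, α₂] (tauGInv ξ η Q) = (a : ℂ) ^ D * eval p Q := by
      rw [eval_tauGInv, ← eval_smul_of_isHomogeneous hQ, hp,
        smul_inv_smul₀ (Complex.ofReal_ne_zero.mpr ha0.ne')]
      rfl
    have hn : ‖((κ : ℂ) ^ D)⁻¹‖ = (κ ^ D)⁻¹ := by
      rw [norm_inv, norm_pow, Complex.norm_real, Real.norm_of_nonneg (by linarith)]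
    have hhom : (((κ : ℂ) ^ D)⁻¹ • tauGInv ξ η Q).IsHomogeneous D :=
      isHomogeneous_smul _ (isHomogeneous_tauGInv ξ η hQ)
    have h := norm_eval_le_Isup hαi (((hQv.tauGInv hη).smul ((κ : ℂ) ^ D)⁻¹).mem_Igam hhom) hhom
      ((pnorm_le_plen _).trans (by
        rw [plen_smul, hn, inv_mul_le_iff₀ hκD]
        exact (plen_tauGInv_le ξ η hQ).trans (mul_le_mul_of_nonneg_left hQlen hκD.le)))
    rwa [smul_eval, norm_mul, hn, inv_mul_le_iff₀ hκD, hev, norm_mul, norm_pow,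
      Complex.norm_real, Real.norm_of_nonneg ha0.le] at h
  have hI0 : 0 ≤ Isup ξ η T D ![α₀, α₁, α₂] := by
    have : 0 ≤ κ ^ D * Isup ξ η T D ![α₀, α₁, α₂] := le_trans (by positivity) hQα
    exact nonneg_of_mul_nonneg_right this (by positivity)
  calc pdist ξ η α₀ α₁ α₂ ^ T
      ≤ (2 * (1 + ‖ξ‖) * a * ρ) ^ T := pow_le_pow_left₀ hdist0 hdist T
    _ = (2 * (1 + ‖ξ‖)) ^ T * a ^ T * ρ ^ T := by rw [mul_pow, mul_pow]
    _ ≤ (2 * (1 + ‖ξ‖)) ^ T * a ^ T * (B * ‖eval p Q‖) := by gcongr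
    _ = (2 * (1 + ‖ξ‖)) ^ T * a ^ (T - D) * B * (a ^ D * ‖eval p Q‖) := by
      rw [← Nat.sub_add_cancel hDT, pow_add a, Nat.sub_add_cancel hDT]
      ring
    _ ≤ (2 * (1 + ‖ξ‖)) ^ T * κ ^ (T - D) * B * (κ ^ D * Isup ξ η T D ![α₀, α₁, α₂]) := by
      gcongr
    _ = (2 * (1 + ‖ξ‖) * κ) ^ T * B * Isup ξ η T D ![α₀, α₁, α₂] := by
      rw [mul_pow _ κ, ← Nat.sub_add_cancel hDT, pow_add κ, Nat.sub_add_cancel hDT]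
      ring
    _ ≤ c5c ξ η ^ T * (T : ℝ) ^ (6 * (T : ℝ) * Real.log T) * Isup ξ η T D ![α₀, α₁, α₂] := by
      have hc5 : 0 ≤ c5c ξ η := le_trans (by positivity) (le_c5c ξ η)
      gcongr
      · exact le_c5c ξ η
      · exact pow_clog_le_rpow hT15
end

section
/- Let m ≥ 1, let D ≥ 1 be an integer, let P₀,…,P_m be a regular sequence of ℂ[X₀,…,X_m] consisting of homogeneous polynomials of degree D, and let ν be an integer with ν ≥ (m+1)D − m. Then there exist ℂ-subspaces E₀,…,E_m of ℂ[X]_{ν−D} with dim_ℂ(E_m) = D^m such that ℂ[X]_ν is the internal direct sum ℂ[X]_ν = E₀P₀ ⊕ ⋯ ⊕ E_mP_m of the subspaces E_jP_j = {A·P_j : A ∈ E_j}. -/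
open MvPolynomial

namespace MvPolynomial

variable {σ K : Type*} [Field K]

/-- The degree `n` part of an ideal of a polynomial ring. -/
noncomputable def idealPart (I : Ideal (MvPolynomial σ K)) (n : ℕ) : Submodule K (MvPolynomial σ K) :=
  I.restrictScalars K ⊓ homogeneousSubmodule σ K n

theorem mem_idealPart {I : Ideal (MvPolynomial σ K)} {n : ℕ} {p : MvPolynomial σ K} :
    p ∈ idealPart I n ↔ p ∈ I ∧ p.IsHomogeneous n := Iff.rfl

attribute [local instance] MvPolynomial.gradedAlgebra

theorem coe_decompose_homogeneousSubmodule (p : MvPolynomial σ K) (n : ℕ) :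
    (DirectSum.decompose (homogeneousSubmodule σ K) p n : MvPolynomial σ K) =
      homogeneousComponent n p :=
  decomposition.decompose'_apply p n

theorem homogeneousComponent_mul_of_le {p : MvPolynomial σ K} {D n : ℕ} (hp : p.IsHomogeneous D)
    (q : MvPolynomial σ K) (h : D ≤ n) :
    homogeneousComponent n (p * q) = p * homogeneousComponent (n - D) q := by
  have := DirectSum.coe_decompose_mul_of_left_mem_of_le (homogeneousSubmodule σ K) (b := q)
    (a := p) (i := D) (n := n) hp h
  simpa only [coe_decompose_homogeneousSubmodule] using this

theorem homogeneousComponent_mul_of_not_le {p : MvPolynomial σ K} {D n : ℕ}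
    (hp : p.IsHomogeneous D) (q : MvPolynomial σ K) (h : ¬ D ≤ n) :
    homogeneousComponent n (p * q) = 0 := by
  have := DirectSum.coe_decompose_mul_of_left_mem_of_not_le (homogeneousSubmodule σ K) (b := q)
    (a := p) (i := D) (n := n) hp h
  simpa only [coe_decompose_homogeneousSubmodule] using this

theorem exists_eq_add_of_mem_idealPart_sup_span {I : Ideal (MvPolynomial σ K)}
    (hI : I.IsHomogeneous (homogeneousSubmodule σ K)) {p x : MvPolynomial σ K} {n : ℕ}
    (hx : x ∈ idealPart (I ⊔ Ideal.span {p}) n) :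
    ∃ b ∈ idealPart I n, ∃ a, x = b + homogeneousComponent n (p * a) := by
  obtain ⟨hx, hxn⟩ := hx
  obtain ⟨b, hb, c, hc, rfl⟩ := Submodule.mem_sup.1 hx
  obtain ⟨a, rfl⟩ := Ideal.mem_span_singleton'.1 hc
  refine ⟨homogeneousComponent n b, ⟨homogeneousComponent_mem_of_mem hI hb n,
    homogeneousComponent_isHomogeneous n b⟩, a, ?_⟩
  rw [← homogeneousComponent_eq_self hxn, map_add, mul_comm a p]

theorem idealPart_mono {I J : Ideal (MvPolynomial σ K)} (h : I ≤ J) (n : ℕ) :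
    idealPart I n ≤ idealPart J n := fun _ hx => ⟨h hx.1, hx.2⟩

theorem idealPart_sup_span_of_lt {I : Ideal (MvPolynomial σ K)}
    (hI : I.IsHomogeneous (homogeneousSubmodule σ K)) {p : MvPolynomial σ K} {D n : ℕ}
    (hp : p.IsHomogeneous D) (h : n < D) :
    idealPart (I ⊔ Ideal.span {p}) n = idealPart I n := by
  refine le_antisymm (fun x hx => ?_) (idealPart_mono le_sup_left n)
  obtain ⟨b, hb, a, rfl⟩ := exists_eq_add_of_mem_idealPart_sup_span hI hx
  rwa [homogeneousComponent_mul_of_not_le hp a h.not_ge, add_zero]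

theorem idealPart_sup_span {I : Ideal (MvPolynomial σ K)}
    (hI : I.IsHomogeneous (homogeneousSubmodule σ K)) {p : MvPolynomial σ K} {D n : ℕ}
    (hp : p.IsHomogeneous D) {E : Submodule K (MvPolynomial σ K)}
    (hE : idealPart I n ⊔ E = homogeneousSubmodule σ K n) :
    idealPart (I ⊔ Ideal.span {p}) (n + D) =
      idealPart I (n + D) ⊔ E.map (LinearMap.mulLeft K p) := by
  refine le_antisymm (fun x hx => ?_) (sup_le (idealPart_mono le_sup_left _) ?_)
  · obtain ⟨b, hb, a, rfl⟩ := exists_eq_add_of_mem_idealPart_sup_span hI hx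
    rw [homogeneousComponent_mul_of_le hp a (by omega), Nat.add_sub_cancel]
    have ha : homogeneousComponent n a ∈ idealPart I n ⊔ E :=
      hE ▸ homogeneousComponent_isHomogeneous n a
    obtain ⟨c, hc, e, he, hce⟩ := Submodule.mem_sup.1 ha
    rw [← hce, mul_add, ← add_assoc]
    refine Submodule.add_mem_sup (add_mem hb ⟨I.mul_mem_left p hc.1, ?_⟩) ⟨e, he, rfl⟩
    rw [add_comm n D]
    exact hp.mul hc.2
  · rintro _ ⟨e, he, rfl⟩
    have hen : e.IsHomogeneous n :=
      (hE ▸ (le_sup_right : E ≤ idealPart I n ⊔ E) : E ≤ homogeneousSubmodule σ K n) he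
    refine ⟨Ideal.mem_sup_right (Ideal.mul_mem_right _ _ (Ideal.mem_span_singleton_self p)), ?_⟩
    rw [add_comm n D]
    exact hp.mul hen

theorem eq_zero_of_mul_mem {I : Ideal (MvPolynomial σ K)} {p : MvPolynomial σ K}
    (hreg : ∀ q, p * q ∈ I → q ∈ I) {n : ℕ} {E : Submodule K (MvPolynomial σ K)}
    (hE : E ≤ homogeneousSubmodule σ K n) (hd : Disjoint (idealPart I n) E)
    {e : MvPolynomial σ K} (he : e ∈ E) (h : p * e ∈ I) : e = 0 :=
  Submodule.disjoint_def.1 hd e ⟨hreg e h, hE he⟩ he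

theorem disjoint_idealPart_map_mulLeft {I : Ideal (MvPolynomial σ K)} {p : MvPolynomial σ K}
    (hreg : ∀ q, p * q ∈ I → q ∈ I) {n : ℕ} {E : Submodule K (MvPolynomial σ K)}
    (hE : E ≤ homogeneousSubmodule σ K n) (hd : Disjoint (idealPart I n) E) (k : ℕ) :
    Disjoint (idealPart I k) (E.map (LinearMap.mulLeft K p)) := by
  rw [Submodule.disjoint_def]
  rintro _ hx ⟨e, he, rfl⟩
  rw [eq_zero_of_mul_mem hreg hE hd he hx.1, map_zero]

theorem finrank_map_mulLeft {I : Ideal (MvPolynomial σ K)} {p : MvPolynomial σ K}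
    (hreg : ∀ q, p * q ∈ I → q ∈ I) {n : ℕ} {E : Submodule K (MvPolynomial σ K)}
    (hE : E ≤ homogeneousSubmodule σ K n) (hd : Disjoint (idealPart I n) E) :
    Module.finrank K (E.map (LinearMap.mulLeft K p)) = Module.finrank K E := by
  have hinj : Function.Injective ((LinearMap.mulLeft K p).domRestrict E) := by
    rw [← LinearMap.ker_eq_bot, LinearMap.ker_eq_bot']
    rintro ⟨e, he⟩ h
    have h' : p * e = 0 := h
    exact Subtype.ext (eq_zero_of_mul_mem hreg hE hd he (h' ▸ I.zero_mem))
  rw [← LinearMap.finrank_range_of_inj hinj, LinearMap.range_domRestrict]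

theorem finrank_homogeneousSubmodule [Fintype σ] (n : ℕ) :
    (Module.finrank K (homogeneousSubmodule σ K n) : ℤ) =
      PowerSeries.coeff n ((PowerSeries.mk 1 : PowerSeries ℤ) ^ Fintype.card σ) := by
  classical
  rw [← Finset.card_univ, ← Finset.prod_const, PowerSeries.coeff_prod]
  have hset : {d : σ →₀ ℕ | d.degree = n} =
      ↑(Finset.finsuppAntidiag (Finset.univ : Finset σ) n) := by
    ext d
    simp [Finsupp.degree_eq_sum]
  rw [homogeneousSubmodule_eq_finsupp_supported, hset]
  rw [(AddMonoidAlgebra.supportedEquivFinsupp (R := K) (S := K) _).finrank_eq]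
  simp [Module.finrank_finsupp_self]

theorem finite_homogeneousSubmodule [Finite σ] (n : ℕ) :
    Module.Finite K (homogeneousSubmodule σ K n) :=
  Module.Finite.iff_fg.2 (homogeneousSubmodule_fg σ K n)

/-- The Hilbert series of the quotient of a polynomial ring by an ideal. -/
noncomputable def hilbertSeries (I : Ideal (MvPolynomial σ K)) : PowerSeries ℤ :=
  PowerSeries.mk fun n =>
    (Module.finrank K (homogeneousSubmodule σ K n) : ℤ) - Module.finrank K (idealPart I n)

theorem hilbertSeries_bot_mul [Fintype σ] :
    hilbertSeries (⊥ : Ideal (MvPolynomial σ K)) * (1 - PowerSeries.X) ^ Fintype.card σ = 1 := by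
  have h : hilbertSeries (⊥ : Ideal (MvPolynomial σ K)) =
      (PowerSeries.mk 1 : PowerSeries ℤ) ^ Fintype.card σ := by
    ext n
    have hb : idealPart (⊥ : Ideal (MvPolynomial σ K)) n = ⊥ :=
      (Submodule.eq_bot_iff _).2 fun x hx => hx.1
    rw [← finrank_homogeneousSubmodule (K := K), hilbertSeries, PowerSeries.coeff_mk, hb]
    simp
  rw [h, ← mul_pow, PowerSeries.mk_one_mul_one_sub_eq_one, one_pow]

theorem finrank_sup_of_disjoint {V : Type*} [AddCommGroup V] [Module K V] {s t : Submodule K V}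
    [FiniteDimensional K s] [FiniteDimensional K t] (h : Disjoint s t) :
    Module.finrank K ↥(s ⊔ t) = Module.finrank K s + Module.finrank K t := by
  rw [← Submodule.finrank_sup_add_finrank_inf_eq, h.eq_bot, finrank_bot, add_zero]

theorem finrank_eq_coeff_hilbertSeries [Finite σ] {I : Ideal (MvPolynomial σ K)} {n : ℕ}
    {E : Submodule K (MvPolynomial σ K)} (hd : Disjoint (idealPart I n) E)
    (hE : idealPart I n ⊔ E = homogeneousSubmodule σ K n) :
    (Module.finrank K E : ℤ) = PowerSeries.coeff n (hilbertSeries I) := by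
  have := finite_homogeneousSubmodule (σ := σ) (K := K) n
  have hfI : FiniteDimensional K (idealPart I n) :=
    Submodule.finiteDimensional_of_le (inf_le_right : _ ≤ homogeneousSubmodule σ K n)
  have hfE : FiniteDimensional K E := Submodule.finiteDimensional_of_le (hE ▸ le_sup_right)
  rw [hilbertSeries, PowerSeries.coeff_mk, ← hE, finrank_sup_of_disjoint hd]
  push_cast
  ring

theorem hilbertSeries_sup_span [Finite σ] {I : Ideal (MvPolynomial σ K)}
    (hI : I.IsHomogeneous (homogeneousSubmodule σ K)) {p : MvPolynomial σ K} {D : ℕ}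
    (hp : p.IsHomogeneous D) (hreg : ∀ q, p * q ∈ I → q ∈ I) :
    hilbertSeries (I ⊔ Ideal.span {p}) = hilbertSeries I * (1 - PowerSeries.X ^ D) := by
  ext n
  rw [mul_sub, mul_one, map_sub, PowerSeries.coeff_mul_X_pow']
  split_ifs with h
  · obtain ⟨k, rfl⟩ := Nat.exists_eq_add_of_le' h
    rw [Nat.add_sub_cancel]
    obtain ⟨E, hd, hE⟩ := IsModularLattice.exists_disjoint_and_sup_eq
      (inf_le_right : idealPart I k ≤ homogeneousSubmodule σ K k)
    have hE' : E ≤ homogeneousSubmodule σ K k := hE ▸ le_sup_right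
    have := finite_homogeneousSubmodule (σ := σ) (K := K) k
    have := finite_homogeneousSubmodule (σ := σ) (K := K) (k + D)
    have hfI : FiniteDimensional K (idealPart I (k + D)) :=
      Submodule.finiteDimensional_of_le (inf_le_right : _ ≤ homogeneousSubmodule σ K (k + D))
    have hfE : FiniteDimensional K E := Submodule.finiteDimensional_of_le hE'
    rw [← finrank_eq_coeff_hilbertSeries hd hE, hilbertSeries, hilbertSeries,
      PowerSeries.coeff_mk, PowerSeries.coeff_mk, idealPart_sup_span hI hp hE,
      finrank_sup_of_disjoint (disjoint_idealPart_map_mulLeft hreg hE' hd _),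
      finrank_map_mulLeft hreg hE' hd]
    push_cast
    ring
  · rw [sub_zero, hilbertSeries, hilbertSeries, PowerSeries.coeff_mk, PowerSeries.coeff_mk,
      idealPart_sup_span_of_lt hI hp (not_le.1 h)]

/-- The ideal generated by the first `k` members of a finite family. -/
def initialIdeal {R : Type*} [CommSemiring R] {r : ℕ} (P : Fin r → R) (k : ℕ) : Ideal R :=
  Ideal.span {x | ∃ i : Fin r, i.val < k ∧ x = P i}

theorem initialIdeal_zero {R : Type*} [CommSemiring R] {r : ℕ} (P : Fin r → R) :
    initialIdeal P 0 = ⊥ := by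
  simp [initialIdeal]

theorem initialIdeal_succ {R : Type*} [CommSemiring R] {r : ℕ} (P : Fin r → R) (j : Fin r) :
    initialIdeal P (j + 1) = initialIdeal P j ⊔ Ideal.span {P j} := by
  rw [initialIdeal, initialIdeal, ← Ideal.span_union]
  congr 1
  ext x
  simp only [Set.mem_ofPred_eq, Set.union_singleton, Set.mem_insert_iff]
  constructor
  · rintro ⟨i, hi, rfl⟩
    rcases Nat.lt_succ_iff_lt_or_eq.1 hi with h | h
    · exact Or.inr ⟨i, h, rfl⟩
    · exact Or.inl (by rw [Fin.ext h])
  · rintro (rfl | ⟨i, hi, rfl⟩)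
    · exact ⟨j, Nat.lt_succ_self _, rfl⟩
    · exact ⟨i, Nat.lt_succ_of_lt hi, rfl⟩

theorem isHomogeneous_initialIdeal {r D : ℕ} {P : Fin r → MvPolynomial σ K}
    (hP : ∀ j, (P j).IsHomogeneous D) (k : ℕ) :
    (initialIdeal P k).IsHomogeneous (homogeneousSubmodule σ K) := by
  refine Ideal.homogeneous_span _ _ ?_
  rintro _ ⟨i, -, rfl⟩
  exact ⟨D, hP i⟩

theorem hilbertSeries_initialIdeal_mul [Fintype σ] {r D : ℕ} {P : Fin r → MvPolynomial σ K}
    (hP : ∀ j, (P j).IsHomogeneous D)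
    (hreg : ∀ j : Fin r, ∀ q, P j * q ∈ initialIdeal P j → q ∈ initialIdeal P j)
    {k : ℕ} (hk : k ≤ r) :
    hilbertSeries (initialIdeal P k) * (1 - PowerSeries.X) ^ Fintype.card σ =
      (1 - PowerSeries.X ^ D) ^ k := by
  induction k with
  | zero => rw [initialIdeal_zero, hilbertSeries_bot_mul, pow_zero]
  | succ k ih =>
    rw [initialIdeal_succ P ⟨k, hk⟩, hilbertSeries_sup_span (isHomogeneous_initialIdeal hP _)
      (hP _) (hreg ⟨k, hk⟩), mul_right_comm, ih (by omega), pow_succ]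

theorem supIndep_and_sup_eq_idealPart {r D n : ℕ} {P : Fin r → MvPolynomial σ K}
    (hP : ∀ j, (P j).IsHomogeneous D)
    (hreg : ∀ j : Fin r, ∀ q, P j * q ∈ initialIdeal P j → q ∈ initialIdeal P j)
    {E : Fin r → Submodule K (MvPolynomial σ K)}
    (hd : ∀ j : Fin r, Disjoint (idealPart (initialIdeal P j) n) (E j))
    (hE : ∀ j : Fin r, idealPart (initialIdeal P j) n ⊔ E j = homogeneousSubmodule σ K n)
    {k : ℕ} (hk : k ≤ r) :
    ({j : Fin r | j.val < k} : Finset (Fin r)).SupIndep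
        (fun j => (E j).map (LinearMap.mulLeft K (P j))) ∧
      ({j : Fin r | j.val < k} : Finset (Fin r)).sup
        (fun j => (E j).map (LinearMap.mulLeft K (P j))) =
          idealPart (initialIdeal P k) (n + D) := by
  induction k with
  | zero =>
    have hb : idealPart (⊥ : Ideal (MvPolynomial σ K)) (n + D) = ⊥ :=
      (Submodule.eq_bot_iff _).2 fun x hx => hx.1
    simp [initialIdeal_zero, hb]
  | succ k ih =>
    obtain ⟨hind, hsup⟩ := ih (by omega)
    have hset : ({j : Fin r | j.val < k + 1} : Finset (Fin r)) =
        insert ⟨k, hk⟩ ({j : Fin r | j.val < k} : Finset (Fin r)) := by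
      ext j
      simp [Fin.ext_iff]
      omega
    have hE' : E ⟨k, hk⟩ ≤ homogeneousSubmodule σ K n := hE ⟨k, hk⟩ ▸ le_sup_right
    rw [hset]
    refine ⟨hind.insert ?_, ?_⟩
    · rw [hsup]
      exact (disjoint_idealPart_map_mulLeft (hreg ⟨k, hk⟩) hE' (hd ⟨k, hk⟩) _).symm
    · rw [Finset.sup_insert, hsup, initialIdeal_succ P ⟨k, hk⟩,
        idealPart_sup_span (isHomogeneous_initialIdeal hP _) (hP _) (hE ⟨k, hk⟩), sup_comm]

end MvPolynomial

namespace PowerSeries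

open Polynomial in
theorem exists_polynomial_geom_pow (d k : ℕ) :
    ∃ q : ℤ[X], q.natDegree ≤ k * d ∧ q.eval 1 = ((d + 1 : ℕ) : ℤ) ^ k ∧
      (1 - (PowerSeries.X : PowerSeries ℤ) ^ (d + 1)) ^ k =
        (q : PowerSeries ℤ) * (1 - (PowerSeries.X : PowerSeries ℤ)) ^ k := by
  refine ⟨(∑ i ∈ Finset.range (d + 1), (Polynomial.X : ℤ[X]) ^ i) ^ k, ?_, ?_, ?_⟩
  · refine natDegree_pow_le_of_le k (natDegree_sum_le_of_forall_le _ _ fun i hi => ?_)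
    rw [Polynomial.natDegree_X_pow]
    exact Nat.lt_succ_iff.1 (Finset.mem_range.1 hi)
  · simp [eval_finsetSum]
  · have h := congrArg (fun p : ℤ[X] => (p : PowerSeries ℤ)) (geom_sum_mul_neg (Polynomial.X : ℤ[X]) (d + 1))
    simp only [Polynomial.coe_mul, Polynomial.coe_sub, Polynomial.coe_one, Polynomial.coe_X,
      Polynomial.coe_pow] at h
    rw [← h, mul_pow, Polynomial.coe_pow]

theorem one_sub_X_pow_ne_zero (k : ℕ) : (1 - X : PowerSeries ℤ) ^ k ≠ 0 := by
  refine pow_ne_zero k fun h => ?_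
  have := mk_one_mul_one_sub_eq_one ℤ
  rw [h, mul_zero] at this
  exact zero_ne_one this

theorem coeff_eq_zero_of_mul_one_sub_X_pow {H : PowerSeries ℤ} {d k n : ℕ}
    (h : H * (1 - X) ^ k = (1 - X ^ (d + 1)) ^ k) (hn : k * d < n) : coeff n H = 0 := by
  obtain ⟨q, hq, -, hq'⟩ := exists_polynomial_geom_pow d k
  rw [mul_right_cancel₀ (one_sub_X_pow_ne_zero k) (h.trans hq'), Polynomial.coeff_coe]
  exact Polynomial.coeff_eq_zero_of_natDegree_lt (hq.trans_lt hn)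

theorem coeff_eq_pow_of_mul_one_sub_X_pow {H : PowerSeries ℤ} {d k n : ℕ}
    (h : H * (1 - X) ^ (k + 1) = (1 - X ^ (d + 1)) ^ k) (hn : k * d ≤ n) :
    coeff n H = ((d + 1 : ℕ) : ℤ) ^ k := by
  obtain ⟨q, hq, hq1, hq'⟩ := exists_polynomial_geom_pow d k
  rw [pow_succ', ← mul_assoc] at h
  have hH : H = (q : PowerSeries ℤ) * mk 1 := by
    rw [← mul_right_cancel₀ (one_sub_X_pow_ne_zero k) (h.trans hq'), mul_assoc, mul_comm (1 - X),
      mk_one_mul_one_sub_eq_one, mul_one]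
  rw [hH, coeff_mul, Finset.Nat.sum_antidiagonal_eq_sum_range_succ_mk, ← hq1,
    Polynomial.eval_eq_sum_range' (Nat.lt_succ_of_le (hq.trans hn))]
  simp

end PowerSeries

theorem stmt15 (m : ℕ) (hm : 1 ≤ m) (D : ℕ) (hD : 1 ≤ D)
    (P : Fin (m + 1) → MvPolynomial (Fin (m + 1)) ℂ)
    (hhom : ∀ j, (P j).IsHomogeneous D)
    (hP0 : P 0 ≠ 0)
    (hreg : ∀ j : Fin (m + 1), j ≠ 0 → ∀ Q : MvPolynomial (Fin (m + 1)) ℂ,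
      P j * Q ∈ Ideal.span {R | ∃ i < j, R = P i} →
        Q ∈ Ideal.span {R | ∃ i < j, R = P i})
    (ν : ℕ) (hν : (m + 1) * D ≤ ν + m) :
    ∃ E : Fin (m + 1) → Submodule ℂ (MvPolynomial (Fin (m + 1)) ℂ),
      (∀ j, E j ≤ homogeneousSubmodule (Fin (m + 1)) ℂ (ν - D)) ∧
      Module.finrank ℂ (E (Fin.last m)) = D ^ m ∧
      iSupIndep (fun j => (E j).map (LinearMap.mulLeft ℂ (P j))) ∧
      (⨆ j, (E j).map (LinearMap.mulLeft ℂ (P j))) =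
        homogeneousSubmodule (Fin (m + 1)) ℂ ν := by
  obtain ⟨d, rfl⟩ := Nat.exists_eq_add_of_le' hD
  obtain ⟨n, rfl⟩ : ∃ n, ν = n + (d + 1) := Nat.exists_eq_add_of_le' (by nlinarith)
  have hn : m * d ≤ n := by nlinarith
  rw [Nat.add_sub_cancel]
  have hreg' : ∀ j : Fin (m + 1), ∀ q, P j * q ∈ initialIdeal P j → q ∈ initialIdeal P j := by
    intro j q hq
    by_cases hj : j = 0
    · subst hj
      rw [Fin.val_zero, initialIdeal_zero, Ideal.mem_bot] at hq ⊢
      exact (mul_eq_zero.1 hq).resolve_left hP0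
    · exact hreg j hj q hq
  have hH {k : ℕ} (hk : k ≤ m + 1) := hilbertSeries_initialIdeal_mul hhom hreg' hk
  rw [Fintype.card_fin] at hH
  choose E hd hE using fun j : Fin (m + 1) => IsModularLattice.exists_disjoint_and_sup_eq
    (inf_le_right : idealPart (initialIdeal P j) n ≤ homogeneousSubmodule (Fin (m + 1)) ℂ n)
  obtain ⟨hind, hsup⟩ := supIndep_and_sup_eq_idealPart hhom hreg' hd hE le_rfl
  have huniv : ({j : Fin (m + 1) | j.val < m + 1} : Finset (Fin (m + 1))) = Finset.univ :=
    Finset.filter_true_of_mem fun j _ => j.2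
  rw [huniv] at hind hsup
  refine ⟨E, fun j => hE j ▸ le_sup_right, ?_, iSupIndep_iff_supIndep_univ.2 hind, ?_⟩
  · have h := finrank_eq_coeff_hilbertSeries (hd (Fin.last m)) (hE (Fin.last m))
    rw [Fin.val_last, PowerSeries.coeff_eq_pow_of_mul_one_sub_X_pow (hH (Nat.le_succ m)) hn] at h
    exact_mod_cast h
  · rw [← Finset.sup_univ_eq_iSup, hsup]
    have := finite_homogeneousSubmodule (σ := Fin (m + 1)) (K := ℂ) (n + (d + 1))
    refine Submodule.eq_of_le_of_finrank_eq inf_le_right ?_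
    have h := PowerSeries.coeff_eq_zero_of_mul_one_sub_X_pow (n := n + (d + 1)) (hH le_rfl)
      (by linarith)
    rw [hilbertSeries, PowerSeries.coeff_mk, sub_eq_zero] at h
    exact_mod_cast h.symm
end

section
/- Let R be an irreducible homogeneous polynomial of ℚ[X₀,X₁,X₂]. Then R divides 𝒟R if and only if R is a constant multiple of X₀ or of X₂. -/
open MvPolynomial

/-- The derivation `𝒟 = X₀·∂/∂X₁ + X₂·∂/∂X₂` of `ℚ[X₀,X₁,X₂]`. -/
noncomputable def DQ : MvPolynomial (Fin 3) ℚ → MvPolynomial (Fin 3) ℚ :=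
  fun P => X 0 * pderiv 1 P + X 2 * pderiv 2 P

theorem coeff_X_mul_pderiv_self {σ A : Type*} [CommSemiring A] (i : σ) (P : MvPolynomial σ A)
    (m : σ →₀ ℕ) : coeff m (X i * pderiv i P) = coeff m P * m i := by
  classical
  simp only [coeff_X_mul', Finsupp.mem_support_iff]
  split_ifs with h
  · rw [coeff_pderiv, Finsupp.sub_add_single_one_cancel h]
    congr 1
    rw [Finsupp.tsub_apply, Finsupp.single_eq_same, ← Nat.cast_add_one, Nat.sub_add_cancel]
    exact Nat.one_le_iff_ne_zero.mpr h
  · simp [not_not.mp h]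

theorem coeff_DQ_of_eq_zero (P : MvPolynomial (Fin 3) ℚ) {m : Fin 3 →₀ ℕ} (hm : m 0 = 0) :
    coeff m (DQ P) = coeff m P * m 2 := by
  rw [DQ, coeff_add, coeff_X_mul_pderiv_self, coeff_X_mul']
  simp [hm]

theorem coeff_DQ_add_single (P : MvPolynomial (Fin 3) ℚ) (m : Fin 3 →₀ ℕ) :
    coeff (Finsupp.single 0 1 + m) (DQ P) =
      coeff (m + Finsupp.single 1 1) P * (m 1 + 1) + coeff (Finsupp.single 0 1 + m) P * m 2 := by
  rw [DQ, coeff_add, coeff_X_mul_pderiv_self, coeff_X_mul, coeff_pderiv]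
  simp

theorem exists_eq_single_add {σ : Type*} {i : σ} {m : σ →₀ ℕ} (h : m i ≠ 0) :
    ∃ n, m = Finsupp.single i 1 + n :=
  ⟨m - Finsupp.single i 1, by rw [add_comm, Finsupp.sub_add_single_one_cancel h]⟩

/-- Monomials of an eigenvector of `DQ` have `X₂`-degree equal to the eigenvalue. -/
theorem exponent_two_eq_of_DQ_eq_C_mul {P : MvPolynomial (Fin 3) ℚ} {r : ℚ}
    (h : DQ P = C r * P) {m : Fin 3 →₀ ℕ} (hm : coeff m P ≠ 0) : (m 2 : ℚ) = r := by
  by_contra hne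
  refine hm ?_
  clear hm
  induction ha : m 0 generalizing m with
  | zero =>
    have := congrArg (coeff m) h
    rw [coeff_DQ_of_eq_zero P ha, coeff_C_mul, mul_comm] at this
    exact (mul_eq_mul_right_iff.mp this).resolve_left hne
  | succ a ih =>
    obtain ⟨n, rfl⟩ := exists_eq_single_add (i := (0 : Fin 3)) (m := m) (by omega)
    have := congrArg (coeff (Finsupp.single 0 1 + n)) h
    have hn : ((n + Finsupp.single 1 1 : Fin 3 →₀ ℕ) 2 : ℚ) ≠ r := by simpa using hne
    rw [coeff_DQ_add_single, coeff_C_mul, ih hn (by simp at ha ⊢; omega), zero_mul, zero_add,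
      mul_comm] at this
    exact (mul_eq_mul_right_iff.mp this).resolve_left (by simpa using hne)

/-- Monomials of an eigenvector of `DQ` do not involve `X₁`. -/
theorem exponent_one_eq_zero_of_DQ_eq_C_mul {P : MvPolynomial (Fin 3) ℚ} {r : ℚ}
    (h : DQ P = C r * P) {m : Fin 3 →₀ ℕ} (hm : coeff m P ≠ 0) : m 1 = 0 := by
  by_contra hne
  obtain ⟨n, rfl⟩ := exists_eq_single_add hne
  have h2 := exponent_two_eq_of_DQ_eq_C_mul h hm
  have := congrArg (coeff (Finsupp.single 0 1 + n)) h
  rw [coeff_DQ_add_single, coeff_C_mul] at this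
  simp only [Finsupp.add_apply, ne_eq, Fin.reduceEq, not_false_eq_true, Finsupp.single_eq_of_ne,
    zero_add] at h2
  rw [h2, add_comm n, mul_comm r, add_eq_right] at this
  exact mul_ne_zero hm (by positivity) this

theorem X_dvd_of_forall_coeff_ne_zero {σ A : Type*} [CommSemiring A] {i : σ}
    {P : MvPolynomial σ A} (h : ∀ m, coeff m P ≠ 0 → m i ≠ 0) : X i ∣ P := by
  rw [P.as_sum]
  refine Finset.dvd_sum fun m hm => ?_
  exact X_dvd_monomial.mpr (Or.inr (h m (mem_support_iff.mp hm)))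

theorem Irreducible.exists_eq_C_mul_X {σ K : Type*} [Field K] {i : σ} {P : MvPolynomial σ K}
    (hP : Irreducible P) (h : X i ∣ P) : ∃ c : K, P = C c * X i := by
  obtain ⟨Q, rfl⟩ := h
  have hQ := (hP.isUnit_or_isUnit rfl).resolve_left X_prime.not_isUnit
  obtain ⟨c, -, rfl⟩ := isUnit_iff_eq_C_of_isReduced.mp hQ
  exact ⟨c, mul_comm _ _⟩

theorem MvPolynomial.IsHomogeneous.DQ {P : MvPolynomial (Fin 3) ℚ} {d : ℕ}
    (hP : P.IsHomogeneous d) (hd : d ≠ 0) : (DQ P).IsHomogeneous d := by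
  have key (i j : Fin 3) : (X i * pderiv j P).IsHomogeneous d := by
    have := (isHomogeneous_X ℚ i).mul (hP.pderiv (i := j))
    rwa [Nat.add_sub_cancel' (Nat.one_le_iff_ne_zero.mpr hd)] at this
  exact (key 0 1).add (key 2 2)

theorem exists_DQ_eq_C_mul_of_dvd {P : MvPolynomial (Fin 3) ℚ} {d : ℕ}
    (hP : P.IsHomogeneous d) (hd : d ≠ 0) (h : P ∣ DQ P) : ∃ r : ℚ, DQ P = C r * P := by
  obtain ⟨S, hS⟩ := h
  by_cases h0 : DQ P = 0
  · exact ⟨0, by simp [h0]⟩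
  have hne : P ≠ 0 ∧ S ≠ 0 := mul_ne_zero_iff.mp (hS ▸ h0)
  have hdeg := (hP.DQ hd).totalDegree h0
  rw [hS, totalDegree_mul_of_isDomain hne.1 hne.2, hP.totalDegree hne.1, add_eq_left] at hdeg
  refine ⟨S.coeff 0, ?_⟩
  rw [← totalDegree_eq_zero_iff_eq_C.mp hdeg, hS, mul_comm]

theorem stmt16 (R : MvPolynomial (Fin 3) ℚ) (hirr : Irreducible R)
    (hhom : ∃ d, R.IsHomogeneous d) :
    R ∣ DQ R ↔ ((∃ c : ℚ, R = C c * X 0) ∨ (∃ c : ℚ, R = C c * X 2)) := by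
  constructor
  · intro h
    obtain ⟨d, hd⟩ := hhom
    have hd0 : d ≠ 0 := by
      rintro rfl
      have hR := totalDegree_eq_zero_iff_eq_C.mp ((totalDegree_zero_iff_isHomogeneous _).mpr hd)
      refine hirr.not_isUnit (isUnit_iff_eq_C_of_isReduced.mpr ⟨_, ?_, hR⟩)
      refine isUnit_iff_ne_zero.mpr fun h0 => hirr.ne_zero ?_
      rw [hR, h0, C_0]
    obtain ⟨r, hr⟩ := exists_DQ_eq_C_mul_of_dvd hd hd0 h
    by_cases hr0 : r = 0
    · refine Or.inl (hirr.exists_eq_C_mul_X (X_dvd_of_forall_coeff_ne_zero fun m hm h0 => hd0 ?_))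
      have h1 := exponent_one_eq_zero_of_DQ_eq_C_mul hr hm
      have h2 := exponent_two_eq_of_DQ_eq_C_mul hr hm
      rw [hr0, Nat.cast_eq_zero] at h2
      have hm0 : m = 0 := by
        ext i
        fin_cases i <;> assumption
      simpa [hm0] using (hd hm).symm
    · refine Or.inr (hirr.exists_eq_C_mul_X (X_dvd_of_forall_coeff_ne_zero fun m hm h0 => hr0 ?_))
      rw [← exponent_two_eq_of_DQ_eq_C_mul hr hm, h0, Nat.cast_zero]
  · rintro (⟨c, rfl⟩ | ⟨c, rfl⟩)
    · simp [DQ, pderiv_X]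
    · simp [DQ, pderiv_X, mul_comm]
end

section
/- Let D be a positive integer and let P ∈ ℚ[X₀,X₁,X₂] be homogeneous of degree D with X₀ ∤ P and X₂ ∤ P. If an irreducible homogeneous polynomial R ∈ ℚ[X₀,X₁,X₂] divides P, 𝒟P, …, 𝒟^k P for some integer k ≥ 0, then R^{k+1} divides P. In particular, the polynomials P, 𝒟P, …, 𝒟^D P have no common irreducible factor in ℚ[X₀,X₁,X₂]. -/
open MvPolynomial

theorem coeff_DQ (R : MvPolynomial (Fin 3) ℚ) (m : Fin 3 →₀ ℕ) :
    coeff m (DQ R) =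
      (if m 0 = 0 then 0
        else coeff (m - Finsupp.single 0 1 + Finsupp.single 1 1) R * (m 1 + 1)) +
      coeff m R * m 2 := by
  classical
  have h2 : coeff m (X 2 * pderiv 2 R) = coeff m R * m 2 := by
    rw [coeff_X_mul']
    split_ifs with h
    · rw [Finsupp.mem_support_iff] at h
      have hm : m - Finsupp.single 2 1 + Finsupp.single 2 1 = m :=
        tsub_add_cancel_of_le (by simpa [Nat.one_le_iff_ne_zero] using h)
      have hc : ((m 2 - 1 : ℕ) : ℚ) + 1 = m 2 := by
        exact_mod_cast Nat.succ_pred_eq_of_ne_zero h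
      rw [coeff_pderiv, hm]
      simp [hc]
    · simp [Finsupp.notMem_support_iff.mp h]
  rw [DQ, coeff_add, h2, coeff_X_mul']
  by_cases h : m 0 = 0 <;> simp [h, coeff_pderiv]

theorem totalDegree_DQ_le (R : MvPolynomial (Fin 3) ℚ) :
    (DQ R).totalDegree ≤ R.totalDegree := by
  refine Finset.sup_le fun m hm => ?_
  rw [mem_support_iff, coeff_DQ] at hm
  by_cases hR : coeff m R = 0
  · have h0 : m 0 ≠ 0 := fun h => hm (by simp [h, hR])
    have h1 : coeff (m - Finsupp.single 0 1 + Finsupp.single 1 1) R ≠ 0 :=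
      fun h => hm (by simp [h, hR])
    have := le_totalDegree (mem_support_iff.mpr h1)
    rw [Finsupp.sum_fintype _ _ (by simp)] at this ⊢
    simp [Fin.sum_univ_three] at this ⊢
    omega
  · exact le_totalDegree (mem_support_iff.mpr hR)

theorem DQ_mul (P Q : MvPolynomial (Fin 3) ℚ) : DQ (P * Q) = DQ P * Q + P * DQ Q := by
  simp only [DQ, pderiv_mul]
  ring

theorem DQ_pow_succ (R : MvPolynomial (Fin 3) ℚ) (n : ℕ) :
    DQ (R ^ (n + 1)) = (n + 1) * R ^ n * DQ R := by
  simp only [DQ, pderiv_pow]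
  push_cast
  ring

theorem exists_coeff_ne_zero_of_not_X_dvd {σ A : Type*} [CommRing A] {i : σ}
    {R : MvPolynomial σ A} (h : ¬ X i ∣ R) : ∃ m, m i = 0 ∧ coeff m R ≠ 0 := by
  contrapose! h
  rw [X_dvd_iff_modMonomial_eq_zero]
  ext m
  by_cases hm : Finsupp.single i 1 ≤ m
  · simp [coeff_modMonomial_of_le _ hm]
  · rw [coeff_modMonomial_of_not_le _ hm, coeff_zero]
    exact h m (by simpa using hm)

/-- A Darboux polynomial of `DQ` divisible by neither `X 0` nor `X 2` does not vanish at the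
origin. -/
theorem coeff_zero_ne_zero_of_dvd_DQ {R : MvPolynomial (Fin 3) ℚ} (h : R ∣ DQ R)
    (h0 : ¬ X 0 ∣ R) (h2 : ¬ X 2 ∣ R) : coeff 0 R ≠ 0 := by
  have hR : R ≠ 0 := by
    rintro rfl
    exact h0 (dvd_zero _)
  obtain ⟨c, hc⟩ : ∃ c : ℚ, DQ R = C c * R := by
    obtain ⟨S, hS⟩ := h
    rcases eq_or_ne S 0 with rfl | hS0
    · exact ⟨0, by simp [hS]⟩
    · have := totalDegree_DQ_le R
      rw [hS, totalDegree_mul_of_isDomain hR hS0] at this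
      have hS' := totalDegree_eq_zero_iff_eq_C.mp (show S.totalDegree = 0 by omega)
      exact ⟨coeff 0 S, by rw [hS, ← hS', mul_comm]⟩
  have key (m : Fin 3 →₀ ℕ) := (coeff_DQ R m).symm.trans (by rw [hc, coeff_C_mul])
  have hc0 : c = 0 := by
    obtain ⟨n, hn2, hn⟩ := exists_coeff_ne_zero_of_not_X_dvd h2
    obtain ⟨m, hm, hmax⟩ := (R.support.filter fun m => m 2 = 0).exists_max_image
      (fun m => m 1) ⟨n, by simp [hn, hn2]⟩
    simp only [Finset.mem_filter, mem_support_iff, and_imp] at hm hmax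
    have hz : coeff (m - Finsupp.single 0 1 + Finsupp.single 1 1) R = 0 := by
      by_contra hne
      have := hmax _ hne (by simp [hm.2])
      simp at this
    simpa [hz, hm.1, hm.2] using key m
  subst hc0
  obtain ⟨m, hm0, hm⟩ := exists_coeff_ne_zero_of_not_X_dvd h0
  have hm2 : m 2 = 0 := by simpa [hm0, hm] using key m
  have hm1 : m 1 = 0 := by
    by_contra hm1
    have hs : m - Finsupp.single 1 1 + Finsupp.single 0 1 - Finsupp.single 0 1
        + Finsupp.single 1 1 = m := by
      rw [add_tsub_cancel_right]
      exact tsub_add_cancel_of_le (by simpa [Nat.one_le_iff_ne_zero] using hm1)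
    have := key (m - Finsupp.single 1 1 + Finsupp.single 0 1)
    rw [hs] at this
    simp [hm, hm2] at this
    norm_cast at this
  have : m = 0 := by
    ext i
    fin_cases i <;> assumption
  rwa [this] at hm

/-- A divisor of a nonzero homogeneous polynomial which does not vanish at the origin is
constant. -/
theorem totalDegree_eq_zero_of_dvd_isHomogeneous {σ A : Type*} [CommRing A] [IsDomain A]
    {P R : MvPolynomial σ A} {D : ℕ} (hP : P.IsHomogeneous D) (hP0 : P ≠ 0) (h : R ∣ P)
    (hR : coeff 0 R ≠ 0) : R.totalDegree = 0 := by
  classical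
  obtain ⟨Q, rfl⟩ := h
  have hQ : Q ≠ 0 := right_ne_zero_of_mul hP0
  have hdeg := hP.totalDegree hP0
  rw [totalDegree_mul_of_isDomain (left_ne_zero_of_mul hP0) hQ] at hdeg
  obtain ⟨m, hm, hmin⟩ := Q.support.exists_min_image Finsupp.degree
    (support_nonempty.mpr hQ)
  have hcoeff : coeff m (R * Q) = coeff 0 R * coeff m Q := by
    rw [coeff_mul]
    refine Finset.sum_eq_single_of_mem (0, m) (by simp) ?_
    rintro ⟨a, b⟩ hab hne
    rw [Finset.HasAntidiagonal.mem_antidiagonal] at hab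
    by_contra hnz
    have hle := hmin b (mem_support_iff.mpr (right_ne_zero_of_mul hnz))
    have hadd : a.degree + b.degree = m.degree := by rw [← map_add, hab]
    have ha : a = 0 := (Finsupp.degree_eq_zero_iff a).mp (by omega)
    subst ha
    exact hne (by simpa using hab)
  have hmD : m.degree = D := by
    by_contra hne
    exact mul_ne_zero hR (mem_support_iff.mp hm) (hcoeff ▸ hP.coeff_eq_zero hne)
  have : m.degree ≤ Q.totalDegree := le_totalDegree hm
  omega

theorem pow_succ_dvd_of_dvd_iterate_DQ {R : MvPolynomial (Fin 3) ℚ} (hR : Irreducible R)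
    (hDR : ¬ R ∣ DQ R) (k : ℕ) (P : MvPolynomial (Fin 3) ℚ)
    (h : ∀ i ≤ k, R ∣ DQ^[i] P) : R ^ (k + 1) ∣ P := by
  induction k generalizing P with
  | zero => simpa using h 0 le_rfl
  | succ k ih =>
    obtain ⟨Q, rfl⟩ := ih P fun i hi => h i (by omega)
    have hD : R ^ (k + 1) ∣ DQ (R ^ (k + 1) * Q) := ih _ fun i hi => by
      simpa using h (i + 1) (by omega)
    rw [DQ_mul, DQ_pow_succ, dvd_add_left (dvd_mul_right _ _)] at hD
    have hdvd : R ^ k * R ∣ R ^ k * (C ((k : ℚ) + 1) * (DQ R * Q)) := by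
      rw [← pow_succ]
      convert hD using 1
      simp only [map_add, map_natCast, map_one]
      ring
    have hunit : IsUnit (C ((k : ℚ) + 1) : MvPolynomial (Fin 3) ℚ) :=
      (IsUnit.mk0 _ (by positivity)).map C
    rw [mul_dvd_mul_iff_left (pow_ne_zero k hR.ne_zero), hunit.dvd_mul_left] at hdvd
    rw [pow_succ]
    exact mul_dvd_mul_left _ ((hR.prime.dvd_or_dvd hdvd).resolve_left hDR)

theorem stmt17 (D : ℕ) (hD : 0 < D) (P : MvPolynomial (Fin 3) ℚ)
    (hhom : P.IsHomogeneous D) (h0 : ¬ X 0 ∣ P) (h2 : ¬ X 2 ∣ P) :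
    (∀ R : MvPolynomial (Fin 3) ℚ, Irreducible R → (∃ d, R.IsHomogeneous d) →
      ∀ k : ℕ, (∀ i ≤ k, R ∣ DQ^[i] P) → R ^ (k + 1) ∣ P) ∧
    ¬ ∃ R : MvPolynomial (Fin 3) ℚ, Irreducible R ∧ ∀ i ≤ D, R ∣ DQ^[i] P := by
  have hP : P ≠ 0 := by
    rintro rfl
    exact h0 (dvd_zero _)
  have hdeg {R : MvPolynomial (Fin 3) ℚ} (hR : Irreducible R) : R.totalDegree ≠ 0 := by
    intro h
    have hC := totalDegree_eq_zero_iff_eq_C.mp h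
    have hc : coeff 0 R ≠ 0 := fun hc => hR.ne_zero (by rw [hC, hc, C_0])
    exact hR.not_isUnit (hC ▸ (IsUnit.mk0 _ hc).map C)
  have main {R : MvPolynomial (Fin 3) ℚ} (hR : Irreducible R) (k : ℕ)
      (h : ∀ i ≤ k, R ∣ DQ^[i] P) : R ^ (k + 1) ∣ P := by
    have hRP : R ∣ P := h 0 (Nat.zero_le k)
    refine pow_succ_dvd_of_dvd_iterate_DQ hR (fun hDR => hdeg hR ?_) k P h
    exact totalDegree_eq_zero_of_dvd_isHomogeneous hhom hP hRP
      (coeff_zero_ne_zero_of_dvd_DQ hDR (fun h => h0 (h.trans hRP)) fun h => h2 (h.trans hRP))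
  refine ⟨fun R hR _ k h => main hR k h, ?_⟩
  rintro ⟨R, hR, h⟩
  have hpow (n : ℕ) : (R ^ n).totalDegree = n * R.totalDegree := by
    induction n with
    | zero => simp
    | succ n ih =>
      rw [pow_succ, totalDegree_mul_of_isDomain (pow_ne_zero n hR.ne_zero) hR.ne_zero, ih]
      ring
  have hle := totalDegree_le_of_dvd_of_isDomain (main hR D h) hP
  rw [hhom.totalDegree hP, hpow] at hle
  have := Nat.le_mul_of_pos_right (D + 1) (Nat.pos_of_ne_zero (hdeg hR))
  omega
end

section
/- Let D ∈ ℕ* and let α = (α₀,α₁,α₂) ∈ ℂ³ be non-zero. Suppose that there exists a non-zero homogeneous polynomial P ∈ ℂ[X₀,X₁,X₂] of degree D, not divisible by X₀ nor by X₂, such that 𝒟^i P(α₀,α₁,α₂) = 0 for i = 0,…,D. Then either α₀·α₂ ≠ 0, or α₀ = α₁ = 0, or α₀ = α₂ = 0 (i.e. the point (α₀:α₁:α₂) of ℙ²(ℂ) is one of (0:1:0) or (0:0:1)). -/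
open MvPolynomial

/-- A substitution that turns `DD` into `a · d/dY` on the variables does so everywhere. -/
theorem aeval_DD (a : Polynomial ℂ) (f : Fin 3 → Polynomial ℂ)
    (h0 : a * (f 0).derivative = 0) (h1 : a * (f 1).derivative = f 0)
    (h2 : a * (f 2).derivative = f 2) (P : MvPolynomial (Fin 3) ℂ) :
    aeval f (DD P) = a * (aeval f P).derivative := by
  induction P using MvPolynomial.induction_on with
  | C c => simp [DD]
  | add p q hp hq =>
    have h : DD (p + q) = DD p + DD q := by simp only [DD, map_add]; ring
    rw [h, map_add, hp, hq, map_add, Polynomial.derivative_add, mul_add]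
  | mul_X p i hp =>
    have h : DD (p * X i) = DD p * X i + p * DD (X i) := by
      simp only [DD, Derivation.leibniz, smul_eq_mul]; ring
    have hX : aeval f (DD (X i)) = a * (f i).derivative := by
      fin_cases i <;> simp [DD, pderiv_X, h0, h1, h2]
    rw [h, map_add, map_mul, map_mul, hp, hX, map_mul, aeval_X, Polynomial.derivative_mul]
    ring

theorem aeval_iterate_DD (a : Polynomial ℂ) (f : Fin 3 → Polynomial ℂ)
    (h0 : a * (f 0).derivative = 0) (h1 : a * (f 1).derivative = f 0)
    (h2 : a * (f 2).derivative = f 2) (P : MvPolynomial (Fin 3) ℂ) (n : ℕ) :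
    aeval f (DD^[n] P) = (fun Q => a * Polynomial.derivative Q)^[n] (aeval f P) :=
  have h : Function.Semiconj (aeval f) DD fun Q => a * Polynomial.derivative Q :=
    aeval_DD a f h0 h1 h2
  h.iterate_right n P

theorem coeff_iterate_X_mul_derivative (Q : Polynomial ℂ) (n k : ℕ) :
    ((fun Q => Polynomial.X * Polynomial.derivative Q)^[n] Q).coeff k =
      Q.coeff k * (k : ℂ) ^ n := by
  induction n with
  | zero => simp
  | succ n ih =>
    rw [Function.iterate_succ_apply']
    cases k with
    | zero => simp
    | succ k =>
      rw [Polynomial.coeff_X_mul, Polynomial.coeff_derivative, ih]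
      push_cast
      ring

/-- A polynomial of degree at most `D` is zero if its first `D` iterates under the Euler
derivation vanish at `1`. -/
theorem eq_zero_of_eval_one_iterate_X_mul_derivative {Q : Polynomial ℂ} {D : ℕ}
    (hQ : Q.natDegree ≤ D)
    (h : ∀ i ≤ D, ((fun Q => Polynomial.X * Polynomial.derivative Q)^[i] Q).eval 1 = 0) :
    Q = 0 := by
  have hv : (fun k : Fin (D + 1) => Q.coeff k) = 0 := by
    refine Matrix.eq_zero_of_forall_pow_sum_mul_pow_eq_zero
      (f := fun k : Fin (D + 1) => ((k : ℕ) : ℂ)) (fun a b hab => ?_) fun i => ?_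
    · exact Fin.ext (by simpa using hab)
    · have hdeg : ((fun Q => Polynomial.X * Polynomial.derivative Q)^[(i : ℕ)] Q).natDegree
          < D + 1 := by
        refine Nat.lt_succ_of_le (Polynomial.natDegree_le_iff_coeff_eq_zero.2 fun k hk => ?_)
        rw [coeff_iterate_X_mul_derivative,
          Polynomial.coeff_eq_zero_of_natDegree_lt (hQ.trans_lt hk), zero_mul]
      have := h i (Nat.lt_succ_iff.1 i.2)
      rw [Polynomial.eval_eq_sum_range' hdeg] at this
      simpa [coeff_iterate_X_mul_derivative, Finset.sum_range] using this
  ext k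
  by_cases hk : k ≤ D
  · exact congrFun hv ⟨k, Nat.lt_succ_of_le hk⟩
  · rw [Polynomial.coeff_eq_zero_of_natDegree_lt (by lia), Polynomial.coeff_zero]

theorem eq_zero_of_eval_zero_iterate_derivative {Q : Polynomial ℂ} {D : ℕ}
    (hQ : Q.natDegree ≤ D) (h : ∀ i ≤ D, (Polynomial.derivative^[i] Q).eval 0 = 0) : Q = 0 := by
  ext k
  by_cases hk : k ≤ D
  · have := h k hk
    rw [← Polynomial.coeff_zero_eq_eval_zero, Polynomial.coeff_iterate_derivative] at this
    simpa [Nat.descFactorial_self, Nat.factorial_ne_zero] using this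
  · rw [Polynomial.coeff_eq_zero_of_natDegree_lt (by lia), Polynomial.coeff_zero]

theorem MvPolynomial.IsHomogeneous.eval_smul_eq {σ R : Type*} [CommSemiring R]
    {P : MvPolynomial σ R} {D : ℕ} (hP : P.IsHomogeneous D) (c : R) (x : σ → R) :
    eval (c • x) P = c ^ D * eval x P := by
  rw [eval_eq, eval_eq, Finset.mul_sum]
  refine Finset.sum_congr rfl fun d hd => ?_
  have hdeg : ∑ i ∈ d.support, d i = D := by
    rw [← Finsupp.degree_apply, Finsupp.degree_eq_weight_one]
    exact hP (mem_support_iff.1 hd)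
  simp only [Pi.smul_apply, smul_eq_mul, mul_pow, Finset.prod_mul_distrib,
    Finset.prod_pow_eq_pow_sum, hdeg]
  ring

/-- A polynomial vanishing at the points of the hyperplane `x j = 0` with `x k ≠ 0` is divisible
by `X j`. -/
theorem X_dvd_of_forall_eval_eq_zero {σ K : Type*} [Field K] [Infinite K]
    {P : MvPolynomial σ K} {j k : σ} (hjk : k ≠ j)
    (h : ∀ x : σ → K, x j = 0 → x k ≠ 0 → eval x P = 0) : X j ∣ P := by
  classical
  set g : σ → MvPolynomial σ K := Function.update X j 0
  have hg (Q : MvPolynomial σ K) : X j ∣ Q - aeval g Q := by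
    induction Q using MvPolynomial.induction_on with
    | C c => simp
    | add p q hp hq => simpa only [map_add, add_sub_add_comm] using dvd_add hp hq
    | mul_X p i hp =>
      rw [map_mul, aeval_X]
      rcases eq_or_ne i j with rfl | hij
      · simp [g]
      · simpa [g, hij, ← sub_mul] using hp.mul_right (X i)
  have hz : X k * aeval g P = 0 := by
    refine funext fun x => ?_
    by_cases hx : x k = 0
    · simp [hx]
    · have he : eval x (aeval g P) = eval (Function.update x j 0) P := by
        rw [aeval_def, ← coe_eval₂Hom, ← RingHom.comp_apply]
        congr 1
        ext i
        · simp
        · rcases eq_or_ne i j with rfl | hij <;> simp [g, *]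
      rw [map_mul, he, h _ (by simp) (by simpa [hjk] using hx)]
      simp
  have hz' : aeval g P = 0 := (mul_eq_zero.1 hz).resolve_left (X_ne_zero k)
  have := hg P
  rwa [hz', sub_zero] at this

theorem stmt19 (D : ℕ) (hD : 0 < D) (α₀ α₁ α₂ : ℂ)
    (hα : ¬(α₀ = 0 ∧ α₁ = 0 ∧ α₂ = 0))
    (P : MvPolynomial (Fin 3) ℂ) (hP0 : P ≠ 0) (hhom : P.IsHomogeneous D)
    (h0 : ¬ X 0 ∣ P) (h2 : ¬ X 2 ∣ P)
    (hvan : ∀ i ≤ D, eval ![α₀, α₁, α₂] (DD^[i] P) = 0) :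
    α₀ * α₂ ≠ 0 ∨ (α₀ = 0 ∧ α₁ = 0) ∨ (α₀ = 0 ∧ α₂ = 0) := by
  have heval (f : Fin 3 → Polynomial ℂ) (t : ℂ) (R : MvPolynomial (Fin 3) ℂ) :
      (aeval f R).eval t = eval (fun i => (f i).eval t) R := by
    rw [← Polynomial.coe_evalRingHom, aeval_def, hom_eval₂, eval, coe_eval₂Hom]
    congr 1
    ext <;> simp
  have hdeg (f : Fin 3 → Polynomial ℂ) (hf : ∀ i, (f i).natDegree ≤ 1) :
      (aeval f P).natDegree ≤ D := by
    simpa using aeval_natDegree_le P hhom.totalDegree_le f hf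
  rcases eq_or_ne α₀ 0 with rfl | hα₀
  · by_contra! hcon
    obtain ⟨-, h1, h2'⟩ := hcon
    replace h1 := h1 rfl
    replace h2' := h2' rfl
    set f : Fin 3 → Polynomial ℂ :=
      ![0, Polynomial.C α₁, Polynomial.C α₂ * Polynomial.X]
    have hQ : aeval f P = 0 := by
      refine eq_zero_of_eval_one_iterate_X_mul_derivative (D := D) (hdeg f fun i => ?_) fun i hi => ?_
      · fin_cases i
        · simp [f]
        · simp [f]
        · simpa [f] using Polynomial.natDegree_C_mul_le α₂ Polynomial.X
      · rw [← aeval_iterate_DD _ f (by simp [f]) (by simp [f]) (by simp [f, Polynomial.X_mul_C]), heval]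
        convert hvan i hi using 3
        ext j
        fin_cases j <;> simp [f]
    refine h0 (X_dvd_of_forall_eval_eq_zero (k := 1) (by decide) fun x hx0 hx1 => ?_)
    have hx : x = (x 1 / α₁) • fun i => (f i).eval (α₁ * x 2 / (x 1 * α₂)) := by
      ext j
      fin_cases j <;> simp [f, hx0] <;> field_simp
    rw [hx, hhom.eval_smul_eq, ← heval, hQ]
    simp
  · left
    refine mul_ne_zero hα₀ ?_
    rintro rfl
    set f : Fin 3 → Polynomial ℂ :=
      ![Polynomial.C α₀, Polynomial.C α₀ * Polynomial.X + Polynomial.C α₁, 0]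
    have hQ : aeval f P = 0 := by
      refine eq_zero_of_eval_zero_iterate_derivative (D := D) (hdeg f fun i => ?_) fun i hi => ?_
      · fin_cases i
        · simp [f]
        · exact Polynomial.natDegree_linear_le
        · simp [f]
      · have := aeval_iterate_DD 1 f (by simp [f]) (by simp [f]) (by simp [f]) P i
        simp only [one_mul] at this
        rw [← this, heval]
        convert hvan i hi using 3
        ext j
        fin_cases j <;> simp [f]
    refine h2 (X_dvd_of_forall_eval_eq_zero (k := 0) (by decide) fun x hx2 hx0 => ?_)
    have hx : x = (x 0 / α₀) • fun i => (f i).eval (x 1 / x 0 - α₁ / α₀) := by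
      ext j
      fin_cases j <;> simp [f, hx2] <;> field_simp
      ring
    rw [hx, hhom.eval_smul_eq, ← heval, hQ]
    simp
end
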